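/- arXiv:1612.01700 — 2 statements merged into one kernel-verified Lean document; each statement's English description precedes it below -/
import Mathlib

section
/- Let N ≥ 2, 1 ≤ k < N, let Ω ⊂ ℝ^N be a bounded open set satisfying the following uniform interior ball condition (valid in particular for bounded C² domains): there is δ > 0 such that for every x ∈ Ω with d(x) < δ there are a unique y ∈ ∂Ω with d(x) = |y − x| and a point ȳ with B_{2δ}(ȳ) ⊆ Ω and cl(B_{2δ}(ȳ)) ∩ (ℝ^N \ Ω) = {y}. Let H : Ω × ℝ^N → ℝ be continuous and satisfy (SC1) with constant b. If u : Ω → ℝ is an upper semicontinuous viscosity subsolution of 𝒫⁻ₖ(D²u) + H(x,∇u) = 0 in Ω (that is, 𝒫⁻ₖ(D²u) + H(x,∇u) ≥ 0 in the viscosity sense) with u < 0 in Ω, then there is a constant C > 0 such that u(x) ≤ −C d(x) for all x ∈ Ω. -/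
open Metric Filter Topology Set

/-- `𝒫⁻ₖ(D²φ(x))`: the sum of the `k` smallest eigenvalues of the Hessian of `φ` at `x`,
expressed through the min-max representation over orthonormal `k`-frames. -/
noncomputable def Pminus {N : ℕ} (k : ℕ) (φ : EuclideanSpace ℝ (Fin N) → ℝ)
    (x : EuclideanSpace ℝ (Fin N)) : ℝ :=
  sInf {s : ℝ | ∃ ξ : Fin k → EuclideanSpace ℝ (Fin N), Orthonormal ℝ ξ ∧
    s = ∑ i, iteratedFDeriv ℝ 2 φ x ![ξ i, ξ i]}

/-- `𝒫⁺ₖ(D²φ(x))`: the sum of the `k` largest eigenvalues of the Hessian of `φ` at `x`. -/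
noncomputable def Pplus {N : ℕ} (k : ℕ) (φ : EuclideanSpace ℝ (Fin N) → ℝ)
    (x : EuclideanSpace ℝ (Fin N)) : ℝ :=
  sSup {s : ℝ | ∃ ξ : Fin k → EuclideanSpace ℝ (Fin N), Orthonormal ℝ ξ ∧
    s = ∑ i, iteratedFDeriv ℝ 2 φ x ![ξ i, ξ i]}

/-- Viscosity subsolution of `P(D²u) + H(x,∇u) + μ u = f(x)` in `Ω`:
for every `x₀ ∈ Ω` and every `C²` test function `φ` such that `u - φ` has a local
maximum (relative to `Ω`) at `x₀`, one has `P(D²φ(x₀)) + H(x₀,∇φ(x₀)) + μ u(x₀) ≥ f(x₀)`. -/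
def IsViscSubsol {N : ℕ}
    (P : (EuclideanSpace ℝ (Fin N) → ℝ) → EuclideanSpace ℝ (Fin N) → ℝ)
    (Ω : Set (EuclideanSpace ℝ (Fin N)))
    (H : EuclideanSpace ℝ (Fin N) → EuclideanSpace ℝ (Fin N) → ℝ)
    (μ : ℝ) (f : EuclideanSpace ℝ (Fin N) → ℝ)
    (u : EuclideanSpace ℝ (Fin N) → ℝ) : Prop :=
  ∀ x₀ ∈ Ω, ∀ φ : EuclideanSpace ℝ (Fin N) → ℝ, ContDiffAt ℝ 2 φ x₀ →
    IsLocalMaxOn (fun x => u x - φ x) Ω x₀ →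
    f x₀ ≤ P φ x₀ + H x₀ (gradient φ x₀) + μ * u x₀

/-- Viscosity supersolution of `P(D²u) + H(x,∇u) + μ u = f(x)` in `Ω`. -/
def IsViscSupersol {N : ℕ}
    (P : (EuclideanSpace ℝ (Fin N) → ℝ) → EuclideanSpace ℝ (Fin N) → ℝ)
    (Ω : Set (EuclideanSpace ℝ (Fin N)))
    (H : EuclideanSpace ℝ (Fin N) → EuclideanSpace ℝ (Fin N) → ℝ)
    (μ : ℝ) (f : EuclideanSpace ℝ (Fin N) → ℝ)
    (u : EuclideanSpace ℝ (Fin N) → ℝ) : Prop :=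
  ∀ x₀ ∈ Ω, ∀ φ : EuclideanSpace ℝ (Fin N) → ℝ, ContDiffAt ℝ 2 φ x₀ →
    IsLocalMinOn (fun x => u x - φ x) Ω x₀ →
    P φ x₀ + H x₀ (gradient φ x₀) + μ * u x₀ ≤ f x₀

/-- Structure condition (SC1): `|H(x,ξ)| ≤ b‖ξ‖`. -/
def SC1 {N : ℕ} (Ω : Set (EuclideanSpace ℝ (Fin N)))
    (H : EuclideanSpace ℝ (Fin N) → EuclideanSpace ℝ (Fin N) → ℝ) (b : ℝ) : Prop :=
  ∀ x ∈ Ω, ∀ ξ : EuclideanSpace ℝ (Fin N), |H x ξ| ≤ b * ‖ξ‖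

/-- Structure condition (SC2): positive 1-homogeneity in the gradient variable. -/
def SC2 {N : ℕ} (Ω : Set (EuclideanSpace ℝ (Fin N)))
    (H : EuclideanSpace ℝ (Fin N) → EuclideanSpace ℝ (Fin N) → ℝ) : Prop :=
  ∀ x ∈ Ω, ∀ t : ℝ, 0 ≤ t → ∀ ξ : EuclideanSpace ℝ (Fin N), H x (t • ξ) = t * H x ξ

/-- Structure condition (SC3): uniform continuity in `x` through a modulus of continuity. -/
def SC3 {N : ℕ} (Ω : Set (EuclideanSpace ℝ (Fin N)))
    (H : EuclideanSpace ℝ (Fin N) → EuclideanSpace ℝ (Fin N) → ℝ) : Prop :=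
  ∃ ω : ℝ → ℝ, Monotone ω ∧ Filter.Tendsto ω (𝓝[>] (0 : ℝ)) (𝓝 (0 : ℝ)) ∧
    ∀ x ∈ Ω, ∀ y ∈ Ω, ∀ ξ : EuclideanSpace ℝ (Fin N),
      |H x ξ - H y ξ| ≤ ω (‖x - y‖ * (1 + ‖ξ‖))

/-- `Ω ∈ 𝒞_R`: a "hula hoop" domain, i.e. an intersection of a nonempty family of
open balls of the common radius `R`. -/
def HulaHoop {N : ℕ} (R : ℝ) (Ω : Set (EuclideanSpace ℝ (Fin N))) : Prop :=
  ∃ Y : Set (EuclideanSpace ℝ (Fin N)), Y.Nonempty ∧ Ω = ⋂ y ∈ Y, ball y R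

/-- `μ̄ₖ⁻(Ω)`: the supremum (in `EReal`) of those `μ` for which there is an upper
semicontinuous `w < 0` on `cl(Ω)` which is a viscosity subsolution of
`𝒫⁻ₖ(D²w) + H(x,∇w) + μ w = 0` in `Ω`. -/
noncomputable def muBarMinus {N : ℕ} (k : ℕ) (Ω : Set (EuclideanSpace ℝ (Fin N)))
    (H : EuclideanSpace ℝ (Fin N) → EuclideanSpace ℝ (Fin N) → ℝ) : EReal :=
  sSup {m : EReal | ∃ μ : ℝ, m = (μ : EReal) ∧ ∃ w : EuclideanSpace ℝ (Fin N) → ℝ,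
    UpperSemicontinuousOn w (closure Ω) ∧ (∀ x ∈ closure Ω, w x < 0) ∧
    IsViscSubsol (Pminus k) Ω H μ (fun _ => 0) w}

/-- `μₖ⁻(Ω)`: as `μ̄ₖ⁻(Ω)`, but only requiring `w < 0` (and upper semicontinuous) in `Ω`. -/
noncomputable def muMinus {N : ℕ} (k : ℕ) (Ω : Set (EuclideanSpace ℝ (Fin N)))
    (H : EuclideanSpace ℝ (Fin N) → EuclideanSpace ℝ (Fin N) → ℝ) : EReal :=
  sSup {m : EReal | ∃ μ : ℝ, m = (μ : EReal) ∧ ∃ w : EuclideanSpace ℝ (Fin N) → ℝ,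
    UpperSemicontinuousOn w Ω ∧ (∀ x ∈ Ω, w x < 0) ∧
    IsViscSubsol (Pminus k) Ω H μ (fun _ => 0) w}

/-- `μ̄ₖ⁺(Ω)`: the supremum (in `EReal`) of those `μ` for which there is a lower
semicontinuous `w > 0` on `cl(Ω)` which is a viscosity supersolution of
`𝒫⁻ₖ(D²w) + H(x,∇w) + μ w = 0` in `Ω`. -/
noncomputable def muBarPlus {N : ℕ} (k : ℕ) (Ω : Set (EuclideanSpace ℝ (Fin N)))
    (H : EuclideanSpace ℝ (Fin N) → EuclideanSpace ℝ (Fin N) → ℝ) : EReal :=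
  sSup {m : EReal | ∃ μ : ℝ, m = (μ : EReal) ∧ ∃ w : EuclideanSpace ℝ (Fin N) → ℝ,
    LowerSemicontinuousOn w (closure Ω) ∧ (∀ x ∈ closure Ω, 0 < w x) ∧
    IsViscSupersol (Pminus k) Ω H μ (fun _ => 0) w}

/-- `μₖ⁺(Ω)`: as `μ̄ₖ⁺(Ω)`, but only requiring `w > 0` (and lower semicontinuous) in `Ω`. -/
noncomputable def muPlus {N : ℕ} (k : ℕ) (Ω : Set (EuclideanSpace ℝ (Fin N)))
    (H : EuclideanSpace ℝ (Fin N) → EuclideanSpace ℝ (Fin N) → ℝ) : EReal :=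
  sSup {m : EReal | ∃ μ : ℝ, m = (μ : EReal) ∧ ∃ w : EuclideanSpace ℝ (Fin N) → ℝ,
    LowerSemicontinuousOn w Ω ∧ (∀ x ∈ Ω, 0 < w x) ∧
    IsViscSupersol (Pminus k) Ω H μ (fun _ => 0) w}



lemma barrier_fderiv {N : ℕ} (C α K : ℝ) (z p : EuclideanSpace ℝ (Fin N)) :
    HasFDerivAt (fun q => C * (K - Real.exp (-α * ‖q - z‖ ^ 2)))
      ((2 * C * α * Real.exp (-α * ‖p - z‖ ^ 2)) • innerSL ℝ (p - z)) p := by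
  have h1 : HasFDerivAt (fun q : EuclideanSpace ℝ (Fin N) => q - z) (ContinuousLinearMap.id ℝ _) p :=
    (hasFDerivAt_id p).sub_const z
  have h2 := h1.norm_sq
  have h3 := (((h2.const_mul (-α)).exp).const_sub K).const_mul C
  refine h3.congr_fderiv ?_
  ext v
  simp
  ring

lemma barrier_fderiv2 {N : ℕ} (C α K : ℝ) (z p ξ : EuclideanSpace ℝ (Fin N)) :
    iteratedFDeriv ℝ 2 (fun q => C * (K - Real.exp (-α * ‖q - z‖ ^ 2))) p ![ξ, ξ]
      = C * α * Real.exp (-α * ‖p - z‖ ^ 2) * (2 * ‖ξ‖ ^ 2 - 4 * α * (inner ℝ (p - z) ξ) ^ 2) := by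
  rw [iteratedFDeriv_two_apply]
  have : fderiv ℝ (fun q => C * (K - Real.exp (-α * ‖q - z‖ ^ 2))) = fun q : EuclideanSpace ℝ (Fin N) =>
      ((2 * C * α * Real.exp (-α * ‖q - z‖ ^ 2)) • innerSL ℝ (q - z)) := by
    ext1 q; exact (barrier_fderiv C α K z q).fderiv
  rw [this]
  have h1 : HasFDerivAt (fun q : EuclideanSpace ℝ (Fin N) => q - z) (ContinuousLinearMap.id ℝ _) p :=
    (hasFDerivAt_id p).sub_const z
  have h2 := h1.norm_sq
  have h3 := ((h2.const_mul (-α)).exp).const_mul (2 * C * α)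
  have h4 : HasFDerivAt (fun q : EuclideanSpace ℝ (Fin N) => innerSL ℝ (q - z)) (innerSL ℝ : EuclideanSpace ℝ (Fin N) →L[ℝ] _) p := by
    have := (innerSL ℝ : EuclideanSpace ℝ (Fin N) →L[ℝ] _).hasFDerivAt.comp p h1
    exact this
  have h5 : HasFDerivAt (fun q : EuclideanSpace ℝ (Fin N) =>
      ((2 * C * α * Real.exp (-α * ‖q - z‖ ^ 2)) • innerSL ℝ (q - z))) _ p := h3.smul h4
  rw [h5.fderiv]
  have h6 : (innerSL ℝ : EuclideanSpace ℝ (Fin N) →L[ℝ] _) ξ ξ = ‖ξ‖ ^ 2 := by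
    rw [innerSL_apply_apply, real_inner_self_eq_norm_sq]
  simp [h6, inner_sub_left]
  ring

lemma barrier_P {N : ℕ} (k : ℕ) (hk1 : 1 ≤ k) (hkN : k < N) (C α K : ℝ) (hC : 0 < C) (hα : 0 < α)
    (z p : EuclideanSpace ℝ (Fin N)) (hp : p ≠ z) :
    Pminus k (fun q => C * (K - Real.exp (-α * ‖q - z‖ ^ 2))) p ≤
      C * α * Real.exp (-α * ‖p - z‖ ^ 2) * (2 * k - 4 * α * ‖p - z‖ ^ 2) := by
  have hA : 0 < C * α * Real.exp (-α * ‖p - z‖ ^ 2) := by positivity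
  obtain ⟨k, rfl⟩ : ∃ j, k = j + 1 := ⟨k - 1, by omega⟩
  obtain ⟨N, rfl⟩ : ∃ j, N = j + 1 := ⟨N - 1, by omega⟩
  have hn : 0 < ‖p - z‖ := norm_pos_iff.2 (sub_ne_zero.2 hp)
  unfold Pminus
  refine csInf_le ?_ ?_
  · refine ⟨∑ i : Fin (k + 1), C * α * Real.exp (-α * ‖p - z‖ ^ 2) * (- 4 * α * ‖p - z‖ ^ 2), ?_⟩
    rintro s ⟨ξ, hξ, rfl⟩
    refine Finset.sum_le_sum fun i _ => ?_
    rw [barrier_fderiv2]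
    refine mul_le_mul_of_nonneg_left ?_ hA.le
    have h1 := hξ.1 i
    have h2 := abs_real_inner_le_norm (p - z) (ξ i)
    rw [h1, mul_one] at h2
    have h3 : (inner ℝ (p - z) (ξ i)) ^ 2 ≤ ‖p - z‖ ^ 2 := sq_le_sq.2 (by simpa using h2)
    rw [h1]
    nlinarith [mul_le_mul_of_nonneg_left h3 hα.le]
  · obtain ⟨B, hB⟩ := Orthonormal.exists_orthonormalBasis_extension_of_card_eq (𝕜 := ℝ)
      (E := EuclideanSpace ℝ (Fin (N + 1))) (ι := Fin (N + 1)) (by simp)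
      (v := fun _ => (‖p - z‖)⁻¹ • (p - z)) (s := {0}) (by
        rw [orthonormal_iff_ite]
        rintro ⟨i, rfl⟩ ⟨j, rfl⟩
        have h1 : ‖(‖p - z‖)⁻¹ • (p - z)‖ = 1 := by
          rw [norm_smul, norm_inv, norm_norm, inv_mul_cancel₀ hn.ne']
        simp [Set.domRestrict, h1])
    have hB0 := hB 0 rfl
    refine ⟨fun i => B (Fin.castLE hkN.le i), B.orthonormal.comp _ (Fin.castLE_injective _), ?_⟩
    have hpz : p - z = ‖p - z‖ • B 0 := by
      rw [hB0, smul_smul, mul_inv_cancel₀ hn.ne', one_smul]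
    have hin : ∀ i : Fin (k+1), inner ℝ (p - z) (B (Fin.castLE hkN.le i)) = if i = 0 then ‖p - z‖ else 0 := by
      intro i
      conv_lhs => rw [hpz]
      rw [inner_smul_left, orthonormal_iff_ite.1 B.orthonormal]
      have : ((0 : Fin (N+1)) = Fin.castLE hkN.le i) ↔ i = 0 := by
        rw [Fin.ext_iff, Fin.ext_iff]; simp [eq_comm]
      simp [this]
    simp only [barrier_fderiv2, hin, B.norm_eq_one]
    rw [← Finset.mul_sum, Finset.sum_sub_distrib]
    congr 1
    simp [Finset.sum_ite_eq]
    ring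

lemma barrier_grad {N : ℕ} (C α K : ℝ) (z p : EuclideanSpace ℝ (Fin N)) :
    gradient (fun q => C * (K - Real.exp (-α * ‖q - z‖ ^ 2))) p =
      (2 * C * α * Real.exp (-α * ‖p - z‖ ^ 2)) • (p - z) := by
  apply HasGradientAt.gradient
  rw [hasGradientAt_iff_hasFDerivAt]
  refine (barrier_fderiv C α K z p).congr_fderiv ?_
  ext v
  simp [inner_smul_left]

lemma barrier_contDiff {N : ℕ} (C α K : ℝ) (z p : EuclideanSpace ℝ (Fin N)) :
    ContDiffAt ℝ 2 (fun q => C * (K - Real.exp (-α * ‖q - z‖ ^ 2))) p := by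
  have : ContDiff ℝ 2 (fun q : EuclideanSpace ℝ (Fin N) => ‖q - z‖ ^ 2) :=
    (contDiff_id.sub contDiff_const).norm_sq ℝ
  exact (contDiff_const.mul (contDiff_const.sub ((contDiff_const.mul this).exp))).contDiffAt

lemma slope_dist {N : ℕ} (S : Set (EuclideanSpace ℝ (Fin N))) (hS : IsClosed S)
    (z y : EuclideanSpace ℝ (Fin N)) (hz : 0 < infDist z S) (hyS : y ∈ S)
    (hy : dist z y = infDist z S) (huniq : ∀ q ∈ S, dist z q = infDist z S → q = y)
    (σ : ℝ) (hσ : σ < 1) (ε : ℝ) (hε : 0 < ε) :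
    ∃ w, dist w z < ε ∧ infDist z S + σ * dist w z < infDist w S := by
  set D := infDist z S with hD
  have hzy : ‖z - y‖ = D := by rw [← dist_eq_norm, hy]
  set n : EuclideanSpace ℝ (Fin N) := D⁻¹ • (z - y) with hn
  have hn1 : ‖n‖ = 1 := by
    rw [hn, norm_smul, hzy, Real.norm_of_nonneg (by positivity), inv_mul_cancel₀ hz.ne']
  obtain ⟨η, hη, hball⟩ : ∃ η > 0, ∀ q, dist q y < η → σ * ‖z - q‖ < inner ℝ n (z - q) := by
    have hc : ContinuousAt (fun q => inner ℝ n (z - q) - σ * ‖z - q‖) y := by fun_prop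
    have h0 : 0 < inner ℝ n (z - y) - σ * ‖z - y‖ := by
      rw [hn, inner_smul_left, real_inner_self_eq_norm_sq, hzy]
      simp
      field_simp
      nlinarith
    obtain ⟨η, hη, h⟩ := Metric.eventually_nhds_iff.1 (hc.eventually (lt_mem_nhds h0))
    exact ⟨η, hη, fun q hq => by linarith [h hq]⟩
  obtain ⟨ρ, hρ, hproj⟩ : ∃ ρ > 0, ∀ w, dist w z < ρ → ∀ q ∈ S, dist w q = infDist w S →
      dist q y < η := by
    by_cases hne : (S \ ball y η).Nonempty
    · obtain ⟨q0, hq0, hq0d⟩ := (hS.sdiff isOpen_ball).exists_infDist_eq_dist hne z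
      have hlt : D < dist z q0 := by
        refine lt_of_le_of_ne (infDist_le_dist_of_mem hq0.1) fun h => hq0.2 ?_
        rw [huniq q0 hq0.1 h.symm]
        exact mem_ball_self hη
      refine ⟨(dist z q0 - D) / 2, by linarith, fun w hw q hq hwq => ?_⟩
      by_contra hcon
      have h1 : dist z q0 ≤ dist z q := by
        rw [← hq0d]; exact infDist_le_dist_of_mem ⟨hq, by simpa using hcon⟩
      have h2 := dist_triangle z w q
      have h3 : infDist w S ≤ infDist z S + dist w z := infDist_le_infDist_add_dist
      rw [dist_comm z w] at h2
      linarith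
    · refine ⟨1, one_pos, fun w hw q hq hwq => ?_⟩
      by_contra hcon
      exact hne ⟨q, hq, by simpa using hcon⟩
  set h := min ρ ε / 2 with hh
  have hhpos : 0 < h := by positivity
  have hd : dist (z + h • n) z = h := by
    rw [dist_eq_norm, add_sub_cancel_left, norm_smul, hn1, Real.norm_of_nonneg hhpos.le, mul_one]
  refine ⟨z + h • n, ?_, ?_⟩
  · rw [hd]; have := min_le_right ρ ε; linarith
  · obtain ⟨q, hqS, hq⟩ := hS.exists_infDist_eq_dist ⟨y, hyS⟩ (z + h • n)
    have hqy := hproj (z + h • n) (by rw [hd]; have := min_le_left ρ ε; linarith) q hqS hq.symm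
    have h1 := hball q hqy
    have h2 : D ≤ ‖z - q‖ := by rw [← dist_eq_norm]; exact infDist_le_dist_of_mem hqS
    have h3 := real_inner_le_norm (z + h • n - q) (z - q)
    have h4 : inner ℝ (z + h • n - q) (z - q) = ‖z - q‖ ^ 2 + h * inner ℝ n (z - q) := by
      rw [show z + h • n - q = (z - q) + h • n by abel, inner_add_left, inner_smul_left,
        real_inner_self_eq_norm_sq]; simp
    rw [hd, hq, dist_eq_norm]
    have h5 : 0 < ‖z - q‖ := by linarith
    have h6 : (‖z - q‖ + σ * h) * ‖z - q‖ < ‖z + h • n - q‖ * ‖z - q‖ := by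
      nlinarith [mul_lt_mul_of_pos_left h1 hhpos]
    have := lt_of_mul_lt_mul_right h6 h5.le
    linarith

lemma federer {N : ℕ} (S : Set (EuclideanSpace ℝ (Fin N))) (hS : IsClosed S) (δ : ℝ)
    (hu : ∀ z, 0 < infDist z S → infDist z S < δ → ∃ y ∈ S, dist z y = infDist z S ∧
      ∀ q ∈ S, dist z q = infDist z S → q = y)
    (x : EuclideanSpace ℝ (Fin N)) (hx : 0 < infDist x S) (t : ℝ) (ht : 0 ≤ t)
    (hxt : infDist x S + t < δ) :
    ∃ z, infDist z S = infDist x S + t ∧ dist z x = t := by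
  have hcpt : IsCompact (closedBall x t) := isCompact_closedBall x t
  have hne : (closedBall x t).Nonempty := ⟨x, mem_closedBall_self ht⟩
  have hxm : x ∈ closedBall x t := mem_closedBall_self ht
  obtain ⟨z, hz, hzmax⟩ := hcpt.exists_isMaxOn hne (continuous_infDist_pt S).continuousOn
  have hbd : ∀ w, infDist w S ≤ infDist x S + dist w x := fun w => infDist_le_infDist_add_dist
  have key : ∀ σ : ℝ, 0 ≤ σ → σ < 1 → infDist x S + σ * t ≤ infDist z S := by
    intro σ hσ0 hσ
    have hgc : Continuous (fun w => infDist w S - σ * dist w x) :=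
      (continuous_infDist_pt S).sub (continuous_const.mul (continuous_id.dist continuous_const))
    obtain ⟨w, hw, hwmax⟩ := hcpt.exists_isMaxOn hne hgc.continuousOn
    have h1 : infDist x S - σ * dist x x ≤ infDist w S - σ * dist w x := hwmax hxm
    rw [dist_self] at h1
    have hw' : dist w x ≤ t := hw
    have hzw : infDist w S ≤ infDist z S := hzmax hw
    have hwx : 0 ≤ σ * dist w x := by positivity
    rcases hw'.lt_or_eq with hlt | heq
    · exfalso
      obtain ⟨y, hyS, hy, huq⟩ := hu w (by linarith) (by linarith [hbd w])
      obtain ⟨v, hv, hvs⟩ := slope_dist S hS w y (by linarith) hyS hy huq σ hσ (t - dist w x)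
        (by linarith)
      have htri := dist_triangle v w x
      have hvm : v ∈ closedBall x t := by
        rw [mem_closedBall]; linarith
      have h2 : infDist v S - σ * dist v x ≤ infDist w S - σ * dist w x := hwmax hvm
      nlinarith [mul_le_mul_of_nonneg_left htri hσ0]
    · rw [heq] at h1; linarith
  have hge : infDist x S + t ≤ infDist z S := by
    have hlim : Tendsto (fun σ : ℝ => infDist x S + σ * t) (𝓝[<] 1) (𝓝 (infDist x S + 1 * t)) := by
      apply Tendsto.mono_left _ nhdsWithin_le_nhds
      exact (continuous_const.add (continuous_id.mul continuous_const)).tendsto _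
    rw [one_mul] at hlim
    refine le_of_tendsto hlim ?_
    filter_upwards [Ioo_mem_nhdsLT (show (0:ℝ) < 1 by norm_num)] with σ hσ
    exact key σ hσ.1.le hσ.2
  have hz' : dist z x ≤ t := hz
  have := hbd z
  exact ⟨z, by linarith, by linarith⟩

lemma comparison {N : ℕ} (k : ℕ) (hk1 : 1 ≤ k) (hkN : k < N)
    (Ω : Set (EuclideanSpace ℝ (Fin N)))
    (H : EuclideanSpace ℝ (Fin N) → EuclideanSpace ℝ (Fin N) → ℝ) (b : ℝ) (hb : 0 ≤ b)
    (hSC1 : SC1 Ω H b)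
    (u : EuclideanSpace ℝ (Fin N) → ℝ)
    (hu : UpperSemicontinuousOn u Ω)
    (huneg : ∀ x ∈ Ω, u x < 0)
    (hsub : IsViscSubsol (Pminus k) Ω H 0 (fun _ => 0) u)
    (z : EuclideanSpace ℝ (Fin N)) (R : ℝ) (hR : 0 < R) (hball : ball z R ⊆ Ω)
    (α C m : ℝ) (hα : 0 < α) (hC : 0 < C) (hαR : 2 * k + 2 * b * R < α * R ^ 2)
    (hCm : C * (Real.exp (-α * (R / 2) ^ 2) - Real.exp (-α * R ^ 2)) ≤ m)
    (hm : ∀ p ∈ closedBall z (R / 2), u p ≤ -m)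
    (x : EuclideanSpace ℝ (Fin N)) (hx1 : R / 2 ≤ ‖x - z‖) (hx2 : ‖x - z‖ < R) :
    u x ≤ C * (Real.exp (-α * R ^ 2) - Real.exp (-α * ‖x - z‖ ^ 2)) := by
  set K := Real.exp (-α * R ^ 2) with hK
  set φ : EuclideanSpace ℝ (Fin N) → ℝ := fun q => C * (K - Real.exp (-α * ‖q - z‖ ^ 2)) with hφ
  have hφc : Continuous φ := by
    rw [hφ]; fun_prop
  by_contra hcon
  push Not at hcon
  set ε := u x - φ x with hε
  have hεpos : 0 < ε := by rw [hε]; simp only [hφ]; linarith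
  -- the compact set
  set A : Set (EuclideanSpace ℝ (Fin N)) := {p | R / 2 ≤ ‖p - z‖ ∧ ‖p - z‖ ≤ R ∧ φ p ≤ -ε} with hA
  have hAclosed : IsClosed A := by
    have e1 : Continuous (fun p : EuclideanSpace ℝ (Fin N) => ‖p - z‖) := by fun_prop
    exact (isClosed_le continuous_const e1).inter
      ((isClosed_le e1 continuous_const).inter (isClosed_le hφc continuous_const))
  have hAbdd : A ⊆ closedBall z R := fun p hp => by
    rw [mem_closedBall, dist_eq_norm]; exact hp.2.1
  have hAc : IsCompact A := (isCompact_closedBall z R).of_isClosed_subset hAclosed hAbdd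
  have hlt : ∀ p ∈ A, ‖p - z‖ < R := by
    intro p hp
    refine lt_of_le_of_ne hp.2.1 fun h => ?_
    have := hp.2.2
    simp only [hφ, h, hK, sub_self, mul_zero] at this
    linarith
  have hAΩ : A ⊆ Ω := fun p hp => hball (by rw [mem_ball, dist_eq_norm]; exact hlt p hp)
  have hxΩ : x ∈ Ω := hball (by rw [mem_ball, dist_eq_norm]; exact hx2)
  have hxA : x ∈ A := ⟨hx1, hx2.le, by have := huneg x hxΩ; linarith⟩
  have husc : UpperSemicontinuousOn (fun q => u q - φ q) A := by
    have := (hu.mono hAΩ).add (hφc.neg.continuousOn.upperSemicontinuousOn (s := A))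
    simpa [sub_eq_add_neg] using this
  obtain ⟨p, hpA, hpmax⟩ := UpperSemicontinuousOn.exists_isMaxOn ⟨x, hxA⟩ hAc husc
  have hpε : ε ≤ u p - φ p := hpmax hxA
  have hpin : R / 2 < ‖p - z‖ := by
    refine lt_of_le_of_ne hpA.1 fun h => ?_
    have h1 := hm p (by rw [mem_closedBall, dist_eq_norm]; exact h.ge)
    simp only [hφ, ← h] at hpε
    linarith
  have hloc : IsLocalMaxOn (fun q => u q - φ q) Ω p := by
    have e1 : ContinuousAt (fun q : EuclideanSpace ℝ (Fin N) => ‖q - z‖) p := by fun_prop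
    have n1 := e1.eventually (lt_mem_nhds hpin)
    have n2 := e1.eventually (gt_mem_nhds (hlt p hpA))
    have n3 := (n1.and n2).filter_mono (nhdsWithin_le_nhds (s := Ω))
    filter_upwards [n3, self_mem_nhdsWithin] with q hq hqΩ
    by_cases hqe : φ q ≤ -ε
    · exact hpmax (show q ∈ A from ⟨hq.1.le, hq.2.le, hqe⟩)
    · have := huneg q hqΩ
      linarith
  have hmain := hsub p (hAΩ hpA) φ (barrier_contDiff C α K z p) hloc
  have hpz : p ≠ z := by
    rintro rfl
    simp at hpin; linarith
  have hP := barrier_P k hk1 hkN C α K hC hα z p hpz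
  have hH := hSC1 p (hAΩ hpA) (gradient φ p)
  rw [hφ, barrier_grad] at hH
  rw [hφ, barrier_grad] at hmain
  have hH' := (le_abs_self _).trans hH
  rw [norm_smul, Real.norm_of_nonneg (by positivity)] at hH'
  have hE : 0 < C * α * Real.exp (-α * ‖p - z‖ ^ 2) := by positivity
  have hneg : 2 * k - 4 * α * ‖p - z‖ ^ 2 + 2 * b * ‖p - z‖ < 0 := by
    have h1 := hlt p hpA
    have h2 : (R / 2) ^ 2 ≤ ‖p - z‖ ^ 2 := by gcongr
    nlinarith [mul_le_mul_of_nonneg_left h2 hα.le, mul_le_mul_of_nonneg_left h1.le hb]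
  have := mul_neg_of_pos_of_neg hE hneg
  simp only [] at hmain hP
  nlinarith

lemma infDist_frontier_eq {N : ℕ} (Ω : Set (EuclideanSpace ℝ (Fin N))) (hΩ : IsOpen Ω)
    (hne : Ωᶜ.Nonempty) (x : EuclideanSpace ℝ (Fin N)) (hx : x ∈ Ω) :
    (∀ y ∈ Ωᶜ, dist x y = infDist x Ωᶜ → y ∈ frontier Ω) ∧
    infDist x (frontier Ω) = infDist x Ωᶜ := by
  have hcl : IsClosed Ωᶜ := hΩ.isClosed_compl
  have hpos : 0 < infDist x Ωᶜ := (hcl.notMem_iff_infDist_pos hne).1 (by simpa using hx)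
  have hballs : ball x (infDist x Ωᶜ) ⊆ Ω := by
    intro q hq
    by_contra hqn
    have := infDist_le_dist_of_mem (x := x) (show q ∈ Ωᶜ from hqn)
    rw [mem_ball, dist_comm] at hq
    linarith
  have h1 : ∀ y ∈ Ωᶜ, dist x y = infDist x Ωᶜ → y ∈ frontier Ω := by
    intro y hy hd
    rw [hΩ.frontier_eq]
    refine ⟨closure_mono hballs ?_, hy⟩
    rw [closure_ball x hpos.ne', mem_closedBall, dist_comm, hd]
  refine ⟨h1, ?_⟩
  obtain ⟨y, hy, hyd⟩ := hcl.exists_infDist_eq_dist hne x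
  have hyf := h1 y hy hyd.symm
  apply le_antisymm
  · rw [hyd]; exact infDist_le_dist_of_mem hyf
  · refine infDist_le_infDist_of_subset ?_ ⟨y, hyf⟩
    rw [hΩ.frontier_eq]; exact fun q hq => hq.2

/-- Hopf lemma for subsolutions: a negative viscosity subsolution of
`𝒫⁻ₖ(D²u) + H(x,∇u) = 0` in a bounded open set with the uniform interior ball
property satisfies `u(x) ≤ -C d(x)`. -/
theorem statement2 {N : ℕ} (hN : 2 ≤ N) (k : ℕ) (hk1 : 1 ≤ k) (hkN : k < N)
    (Ω : Set (EuclideanSpace ℝ (Fin N))) (hΩopen : IsOpen Ω)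
    (hΩbdd : Bornology.IsBounded Ω)
    (hIB : ∃ δ > (0 : ℝ), ∀ x ∈ Ω, infDist x (frontier Ω) < δ →
      ∃ y ∈ frontier Ω, dist x y = infDist x (frontier Ω) ∧
        (∀ y' ∈ frontier Ω, dist x y' = infDist x (frontier Ω) → y' = y) ∧
        ∃ c : EuclideanSpace ℝ (Fin N), ball c (2 * δ) ⊆ Ω ∧
          closure (ball c (2 * δ)) ∩ Ωᶜ = {y})
    (H : EuclideanSpace ℝ (Fin N) → EuclideanSpace ℝ (Fin N) → ℝ) (b : ℝ) (hb : 0 ≤ b)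
    (hHcont : ContinuousOn (Function.uncurry H)
      (Ω ×ˢ (univ : Set (EuclideanSpace ℝ (Fin N)))))
    (hSC1 : SC1 Ω H b)
    (u : EuclideanSpace ℝ (Fin N) → ℝ)
    (hu : UpperSemicontinuousOn u Ω)
    (huneg : ∀ x ∈ Ω, u x < 0)
    (hsub : IsViscSubsol (Pminus k) Ω H 0 (fun _ => 0) u) :
    ∃ C > (0 : ℝ), ∀ x ∈ Ω, u x ≤ -C * infDist x (frontier Ω) := by
  obtain ⟨δ, hδ, hIB⟩ := hIB
  haveI : Nonempty (Fin N) := ⟨⟨0, by omega⟩⟩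
  have hne : Ωᶜ.Nonempty := by
    rw [nonempty_compl]
    rintro rfl
    exact NormedSpace.unbounded_univ ℝ (EuclideanSpace ℝ (Fin N)) hΩbdd
  have hcl : IsClosed Ωᶜ := hΩopen.isClosed_compl
  have hmem : ∀ z, 0 < infDist z Ωᶜ → z ∈ Ω := by
    intro z hz
    by_contra h
    rw [infDist_zero_of_mem (show z ∈ Ωᶜ from h)] at hz
    exact lt_irrefl _ hz
  have hpos : ∀ z ∈ Ω, 0 < infDist z Ωᶜ := fun z hz =>
    (hcl.notMem_iff_infDist_pos hne).1 (by simpa using hz)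
  have hfr := infDist_frontier_eq Ω hΩopen hne
  have huq : ∀ z, 0 < infDist z Ωᶜ → infDist z Ωᶜ < δ → ∃ y ∈ Ωᶜ, dist z y = infDist z Ωᶜ ∧
      ∀ q ∈ Ωᶜ, dist z q = infDist z Ωᶜ → q = y := by
    intro z hz hzδ
    have hzΩ := hmem z hz
    obtain ⟨h1, h2⟩ := hfr z hzΩ
    obtain ⟨y, hy, hyd, hyu, -⟩ := hIB z hzΩ (by rw [h2]; exact hzδ)
    rw [h2] at hyd hyu
    refine ⟨y, ?_, hyd, fun q hq hqd => hyu q (h1 q hq hqd) hqd⟩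
    rw [hΩopen.frontier_eq] at hy; exact hy.2
  set R := δ / 2 with hRdef
  have hR : 0 < R := by positivity
  -- the compact core
  set Kc : Set (EuclideanSpace ℝ (Fin N)) := {p | R / 2 ≤ infDist p Ωᶜ} with hKc
  have hKΩ : Kc ⊆ Ω := fun p hp => hmem p (lt_of_lt_of_le (by positivity) hp)
  have hKcpt : IsCompact Kc := Metric.isCompact_of_isClosed_isBounded
    (isClosed_le continuous_const (continuous_infDist_pt _)) (hΩbdd.subset hKΩ)
  obtain ⟨m, hm, hmK⟩ : ∃ m > 0, ∀ p ∈ Kc, u p ≤ -m := by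
    rcases Kc.eq_empty_or_nonempty with h | h
    · exact ⟨1, one_pos, by simp [h]⟩
    · obtain ⟨p, hp, hpm⟩ := UpperSemicontinuousOn.exists_isMaxOn h hKcpt (hu.mono hKΩ)
      exact ⟨-u p, by linarith [huneg p (hKΩ hp)], fun q hq => by
        have : u q ≤ u p := hpm hq
        linarith⟩
  obtain ⟨M, hM, hMb⟩ : ∃ M > 0, ∀ p ∈ Ω, infDist p Ωᶜ ≤ M := by
    obtain ⟨q, hq⟩ := hne
    obtain ⟨r, hr⟩ := hΩbdd.subset_closedBall q
    refine ⟨max r 1, by positivity, fun p hp => ?_⟩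
    exact (infDist_le_dist_of_mem hq).trans ((hr hp).trans (le_max_left _ _))
  set α := (2 * k + 2 * b * R + 1) / R ^ 2 with hαdef
  have hα : 0 < α := by positivity
  have hαR : 2 * k + 2 * b * R < α * R ^ 2 := by
    rw [hαdef, div_mul_cancel₀ _ (by positivity)]; linarith
  set Cm := m with hCm
  have hexp1 : Real.exp (-α * (R / 2) ^ 2) - Real.exp (-α * R ^ 2) ≤ 1 := by
    have h1 : Real.exp (-α * (R / 2) ^ 2) ≤ 1 := Real.exp_le_one_iff.2 (by
      have : 0 ≤ α * (R / 2) ^ 2 := by positivity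
      linarith)
    linarith [Real.exp_pos (-α * R ^ 2)]
  have hCm' : m * (Real.exp (-α * (R / 2) ^ 2) - Real.exp (-α * R ^ 2)) ≤ m := by
    nlinarith
  set C1 := m * (Real.exp (-α * R ^ 2) * (α * R)) with hC1
  have hC1pos : 0 < C1 := by positivity
  refine ⟨min C1 (m / M), by positivity, fun x hx => ?_⟩
  rw [(hfr x hx).2]
  have hDx := hpos x hx
  by_cases hxK : R / 2 ≤ infDist x Ωᶜ
  · have h1 := hmK x hxK
    have h2 : min C1 (m / M) * infDist x Ωᶜ ≤ m / M * M :=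
      mul_le_mul (min_le_right _ _) (hMb x hx) hDx.le (by positivity)
    rw [div_mul_cancel₀ _ hM.ne'] at h2
    linarith
  · push Not at hxK
    obtain ⟨z, hzD, hzx⟩ := federer Ωᶜ hcl δ huq x hDx (R - infDist x Ωᶜ) (by linarith)
      (by linarith)
    have hzR : infDist z Ωᶜ = R := by linarith
    have hball : ball z R ⊆ Ω := by
      intro q hq
      by_contra hqn
      have := infDist_le_dist_of_mem (x := z) (show q ∈ Ωᶜ from hqn)
      rw [mem_ball, dist_comm] at hq
      linarith
    have hxz : ‖x - z‖ = R - infDist x Ωᶜ := by rw [← dist_eq_norm, dist_comm, hzx]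
    have hcmp := comparison k hk1 hkN Ω H b hb hSC1 u hu huneg hsub z R hR hball α m m hα hm hαR
      hCm' (fun p hp => hmK p (by
        have h1 : infDist z Ωᶜ ≤ infDist p Ωᶜ + dist z p := infDist_le_infDist_add_dist
        rw [mem_closedBall, dist_comm] at hp
        show R / 2 ≤ infDist p Ωᶜ
        linarith)) x (by linarith) (by linarith)
    rw [hxz] at hcmp
    have h3 : Real.exp (-α * R ^ 2) * (α * R * infDist x Ωᶜ) ≤
        Real.exp (-α * (R - infDist x Ωᶜ) ^ 2) - Real.exp (-α * R ^ 2) := by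
      set d := infDist x Ωᶜ with hd
      have e1 : Real.exp (-α * (R - d) ^ 2) =
          Real.exp (-α * R ^ 2) * Real.exp (α * (R ^ 2 - (R - d) ^ 2)) := by
        rw [← Real.exp_add]; congr 1; ring
      have e2 := Real.add_one_le_exp (α * (R ^ 2 - (R - d) ^ 2))
      have e3 : α * R * d ≤ α * (R ^ 2 - (R - d) ^ 2) := by
        have : R * d ≤ R ^ 2 - (R - d) ^ 2 := by nlinarith
        nlinarith [mul_le_mul_of_nonneg_left this hα.le]
      rw [e1]
      nlinarith [mul_le_mul_of_nonneg_left (e3.trans (by linarith : _ ≤ Real.exp (α * (R ^ 2 - (R - d) ^ 2)) - 1)) (Real.exp_pos (-α * R ^ 2)).le]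
    have h4 : min C1 (m / M) * infDist x Ωᶜ ≤ C1 * infDist x Ωᶜ :=
      mul_le_mul_of_nonneg_right (min_le_left _ _) hDx.le
    have h5 := mul_le_mul_of_nonneg_left h3 hm.le
    have h6 : C1 * infDist x Ωᶜ = m * (Real.exp (-α * R ^ 2) * (α * R * infDist x Ωᶜ)) := by
      rw [hC1]; ring
    linarith
end

section
/- Let N ≥ 2, 1 ≤ k < N, let Ω ⊂ ℝ^N be a bounded open set, and let H : Ω × ℝ^N → ℝ be continuous and satisfy (SC2) and (SC3). If μ < μ̄ₖ⁻(Ω), then the minimum principle holds for 𝒫⁻ₖ(D²·) + H(x,∇·) + μ·: every lower semicontinuous viscosity supersolution u of 𝒫⁻ₖ(D²u) + H(x,∇u) + μu = 0 in Ω (that is, 𝒫⁻ₖ(D²u) + H(x,∇u) + μu ≤ 0 in the viscosity sense) with liminf_{x→∂Ω} u(x) ≥ 0 satisfies u ≥ 0 in Ω. -/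
open Metric Filter Topology Set

section Aux
variable {E : Type*} [NormedAddCommGroup E] [InnerProductSpace ℝ E]

/-- second directional derivative -/
noncomputable def D2 (φ : E → ℝ) (x ξ : E) : ℝ := fderiv ℝ (fderiv ℝ φ) x ξ ξ

theorem D2_eq (φ : E → ℝ) (x ξ : E) : iteratedFDeriv ℝ 2 φ x ![ξ, ξ] = D2 φ x ξ := by
  rw [iteratedFDeriv_two_apply]; rfl

theorem hasDerivAt_line (w : E → ℝ) (x ξ : E) (t : ℝ) (h : DifferentiableAt ℝ w (x + t • ξ)) :
    HasDerivAt (fun t : ℝ => w (x + t • ξ)) (fderiv ℝ w (x + t • ξ) ξ) t := by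
  have h1 : HasDerivAt (fun t : ℝ => x + t • ξ) ξ t := by
    simpa using ((hasDerivAt_id t).smul_const ξ).const_add x
  exact h.hasFDerivAt.comp_hasDerivAt t h1

theorem hasDerivAt_line2 (w : E → ℝ) (x ξ : E) (t : ℝ)
    (h : DifferentiableAt ℝ (fderiv ℝ w) (x + t • ξ)) :
    HasDerivAt (fun t : ℝ => fderiv ℝ w (x + t • ξ) ξ) (D2 w (x + t • ξ) ξ) t := by
  have h1 : HasDerivAt (fun t : ℝ => x + t • ξ) ξ t := by
    simpa using ((hasDerivAt_id t).smul_const ξ).const_add x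
  have h2 := h.hasFDerivAt.comp_hasDerivAt t h1
  have := h2.clm_apply (hasDerivAt_const t ξ)
  simpa [D2] using this

theorem cda_diff1 {φ : E → ℝ} {x : E} (h : ContDiffAt ℝ 2 φ x) : DifferentiableAt ℝ φ x :=
  h.differentiableAt (by norm_num)

theorem cda_diff2 {φ : E → ℝ} {x : E} (h : ContDiffAt ℝ 2 φ x) :
    DifferentiableAt ℝ (fderiv ℝ φ) x :=
  (h.fderiv_right (m := 1) (by norm_num)).differentiableAt (by norm_num)

theorem cda_ev {φ : E → ℝ} {x : E} (h : ContDiffAt ℝ 2 φ x) :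
    ∀ᶠ y in 𝓝 x, DifferentiableAt ℝ φ y := by
  have := h.eventually (by simp)
  filter_upwards [this] with y hy using cda_diff1 hy

theorem D2_add {φ ψ : E → ℝ} {x : E} (hφ : ContDiffAt ℝ 2 φ x) (hψ : ContDiffAt ℝ 2 ψ x) (ξ : E) :
    D2 (fun y => φ y + ψ y) x ξ = D2 φ x ξ + D2 ψ x ξ := by
  have h : fderiv ℝ (fun y => φ y + ψ y) =ᶠ[𝓝 x] fun y => fderiv ℝ φ y + fderiv ℝ ψ y := by
    filter_upwards [cda_ev hφ, cda_ev hψ] with y h1 h2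
    exact fderiv_add h1 h2
  unfold D2
  rw [h.fderiv_eq]
  have := fderiv_add (cda_diff2 hφ) (cda_diff2 hψ)
  rw [show (fun y => fderiv ℝ φ y + fderiv ℝ ψ y) = fderiv ℝ φ + fderiv ℝ ψ from rfl, this]
  simp

theorem D2_const_mul {φ : E → ℝ} {x : E} (hφ : ContDiffAt ℝ 2 φ x) (c : ℝ) (ξ : E) :
    D2 (fun y => c * φ y) x ξ = c * D2 φ x ξ := by
  have h : fderiv ℝ (fun y => c * φ y) =ᶠ[𝓝 x] fun y => c • fderiv ℝ φ y := by
    filter_upwards [cda_ev hφ] with y h1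
    exact fderiv_const_mul h1 c
  unfold D2
  rw [h.fderiv_eq, fderiv_fun_const_smul (cda_diff2 hφ)]
  simp

theorem D2_comp_add (φ : E → ℝ) (x a ξ : E) :
    D2 (fun y => φ (y + a)) x ξ = D2 φ (x + a) ξ := by
  unfold D2
  have : fderiv ℝ (fun y => φ (y + a)) = fun y => fderiv ℝ φ (y + a) := by
    funext y; exact fderiv_comp_add_right a
  rw [this, fderiv_comp_add_right]

theorem D2_sum {ι : Type*} (s : Finset ι) (φ : ι → E → ℝ) (hφ : ∀ i, ContDiff ℝ 2 (φ i))
    (x ξ : E) : D2 (fun y => ∑ i ∈ s, φ i y) x ξ = ∑ i ∈ s, D2 (φ i) x ξ := by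
  classical
  induction s using Finset.induction_on with
  | empty => simp [D2]
  | insert a s ha ih =>
    simp only [Finset.sum_insert ha]
    rw [D2_add (hφ a).contDiffAt (ContDiff.contDiffAt (ContDiff.sum fun i _ => hφ i)), ih]

theorem D2_nonneg_of_isLocalMin {φ : E → ℝ} {x : E} (hφ : ContDiffAt ℝ 2 φ x)
    (h : IsLocalMin φ x) (ξ : E) : 0 ≤ D2 φ x ξ := by
  by_contra! hneg
  set g : ℝ → ℝ := fun t => φ (x + t • ξ) with hg
  have hc : ContinuousAt (fun t : ℝ => x + t • ξ) 0 := by fun_prop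
  have hc' : Tendsto (fun t : ℝ => x + t • ξ) (𝓝 0) (𝓝 x) := by
    have := hc.tendsto; simpa using this
  have hd : deriv g =ᶠ[𝓝 0] fun t => fderiv ℝ φ (x + t • ξ) ξ := by
    filter_upwards [hc'.eventually (cda_ev hφ)] with t ht
    exact (hasDerivAt_line φ x ξ t ht).deriv
  have hdd : deriv (deriv g) 0 = D2 φ x ξ := by
    rw [hd.deriv_eq]
    have := hasDerivAt_line2 φ x ξ 0 (by simpa using cda_diff2 hφ)
    simpa using this.deriv
  have hmin : IsLocalMin g 0 := by
    have := hc'.eventually h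
    filter_upwards [this] with t ht
    simpa [hg] using ht
  have hmax : IsLocalMax g 0 := by
    apply isLocalMax_of_deriv_deriv_neg
    · rw [hdd]; exact hneg
    · exact hmin.deriv_eq_zero
    · exact (hasDerivAt_line φ x ξ 0 (by simpa using cda_diff1 hφ)).continuousAt
  have hcst : g =ᶠ[𝓝 0] fun _ => g 0 := by
    filter_upwards [hmin, hmax] with t h1 h2
    exact le_antisymm h2 h1
  have : deriv (deriv g) 0 = 0 := by
    rw [hcst.deriv.deriv_eq]; simp
  linarith

theorem D2_contDiff {w : E → ℝ} (hw : ContDiff ℝ 4 w) (ξ : E) : ContDiff ℝ 2 (fun x => D2 w x ξ) := by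
  unfold D2
  have h1 : ContDiff ℝ 3 (fderiv ℝ w) := hw.fderiv_right (by norm_num)
  have h2 : ContDiff ℝ 2 (fderiv ℝ (fderiv ℝ w)) := h1.fderiv_right (by norm_num)
  exact (h2.clm_apply contDiff_const).clm_apply contDiff_const

theorem D2_continuous {w : E → ℝ} (hw : ContDiff ℝ 2 w) (ξ : E) :
    Continuous (fun x => D2 w x ξ) := by
  unfold D2
  have h1 : ContDiff ℝ 1 (fderiv ℝ w) := hw.fderiv_right (by norm_num)
  have h2 : ContDiff ℝ 0 (fderiv ℝ (fderiv ℝ w)) := h1.fderiv_right (by norm_num)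
  exact ((h2.clm_apply contDiff_const).clm_apply contDiff_const).continuous

theorem D2_compact {w : E → ℝ} (hw : HasCompactSupport w) (ξ : E) :
    HasCompactSupport (fun x => D2 w x ξ) := by
  have h := (hw.fderiv (𝕜 := ℝ)).fderiv_apply (𝕜 := ℝ) ξ
  refine h.mono fun x hx => ?_
  rw [Function.mem_support] at hx ⊢
  intro h0
  apply hx
  unfold D2
  rw [h0]; rfl

theorem second_diff (w : E → ℝ) (hw : ContDiff ℝ 2 w) (hc : HasCompactSupport w) (e : ℝ)
    (he : 0 < e) (ξ : E) (hξ : ‖ξ‖ = 1) : ∀ᶠ τ in 𝓝[>] (0 : ℝ), ∀ x : E,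
      |(w (x + τ • ξ) + w (x - τ • ξ) - 2 * w x) / τ ^ 2 - D2 w x ξ| ≤ e := by
  have huc : UniformContinuous (fun x => D2 w x ξ) :=
    (D2_compact hc ξ).uniformContinuous_of_continuous (D2_continuous hw ξ)
  obtain ⟨δ, hδ, H⟩ := Metric.uniformContinuous_iff.1 huc (e / 2) (by positivity)
  filter_upwards [Ioo_mem_nhdsGT hδ]
  rintro τ ⟨hτ, hτδ⟩ x
  have hD : ∀ t : ℝ, |t| ≤ τ → |D2 w (x + t • ξ) ξ - D2 w x ξ| ≤ e / 2 := by
    intro t ht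
    have h1 : dist (x + t • ξ) x < δ := by
      simp [dist_eq_norm, norm_smul, hξ]; linarith
    exact (H h1).le
  have hd1 : ∀ y, DifferentiableAt ℝ w y := fun y => cda_diff1 hw.contDiffAt
  have hd2 : ∀ y, DifferentiableAt ℝ (fderiv ℝ w) y := fun y => cda_diff2 hw.contDiffAt
  set A := D2 w x ξ
  set g' : ℝ → ℝ := fun t => fderiv ℝ w (x + t • ξ) ξ - fderiv ℝ w (x + (-t) • ξ) ξ - 2 * t * A
    with hg'
  set g : ℝ → ℝ := fun t => w (x + t • ξ) + w (x + (-t) • ξ) - 2 * w x - t ^ 2 * A with hg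
  have G1 : ∀ t, HasDerivAt g (g' t) t := by
    intro t
    have a1 := hasDerivAt_line w x ξ t (hd1 _)
    have a2 := (hasDerivAt_line w x ξ (-t) (hd1 _)).scomp t (hasDerivAt_neg t)
    have a3 := ((a1.add a2).sub_const (2 * w x)).sub ((hasDerivAt_pow 2 t).mul_const A)
    refine a3.congr_deriv ?_
    simp [hg']; ring
  have G2 : ∀ t, HasDerivAt g' (D2 w (x + t • ξ) ξ + D2 w (x + (-t) • ξ) ξ - 2 * A) t := by
    intro t
    have a1 := hasDerivAt_line2 w x ξ t (hd2 _)
    have a2 := (hasDerivAt_line2 w x ξ (-t) (hd2 _)).scomp t (hasDerivAt_neg t)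
    have a3 := (a1.sub a2).sub (((hasDerivAt_id t).const_mul 2).mul_const A)
    refine a3.congr_deriv ?_
    simp
  have B1 : ∀ t ∈ Icc (0:ℝ) τ, |g' t| ≤ e * τ := by
    intro t ht
    have := norm_image_sub_le_of_norm_deriv_le_segment' (f := g') (a := 0) (b := τ) (C := e)
      (f' := fun t => D2 w (x + t • ξ) ξ + D2 w (x + (-t) • ξ) ξ - 2 * A)
      (fun s _ => (G2 s).hasDerivWithinAt) (fun s hs => by
        have h1 := abs_le.1 (hD s (by rw [abs_of_nonneg hs.1]; exact hs.2.le))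
        have h2 := abs_le.1 (hD (-s) (by rw [abs_neg, abs_of_nonneg hs.1]; exact hs.2.le))
        rw [Real.norm_eq_abs, abs_le]; constructor <;> linarith [h1.1, h1.2, h2.1, h2.2]) t ht
    have h0 : g' 0 = 0 := by simp [hg']
    rw [h0, sub_zero, sub_zero, Real.norm_eq_abs] at this
    nlinarith [ht.1, ht.2]
  have B2 : |g τ| ≤ e * τ * τ := by
    have := norm_image_sub_le_of_norm_deriv_le_segment' (f := g) (a := 0) (b := τ) (C := e * τ)
      (f' := g') (fun s _ => (G1 s).hasDerivWithinAt)
      (fun s hs => B1 s ⟨hs.1, hs.2.le⟩) τ ⟨hτ.le, le_rfl⟩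
    have h0 : g 0 = 0 := by simp [hg]; ring
    rw [h0, sub_zero, sub_zero, Real.norm_eq_abs] at this
    exact this
  have hτ2 : 0 < τ ^ 2 := by positivity
  have : (w (x + τ • ξ) + w (x - τ • ξ) - 2 * w x) / τ ^ 2 - A = g τ / τ ^ 2 := by
    simp only [hg, neg_smul, ← sub_eq_add_neg]; field_simp
  rw [this, abs_div, abs_of_pos hτ2, div_le_iff₀ hτ2]
  linarith [B2, sq τ]
end Aux

section Resolvent
variable {E : Type*} [NormedAddCommGroup E] [InnerProductSpace ℝ E]

/-- discrete second-order operator -/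
noncomputable def Lt {k : ℕ} (ξ : Fin k → E) (τ : ℝ) (G : E → ℝ) (x : E) : ℝ :=
  ∑ i, (G (x + τ • ξ i) + G (x - τ • ξ i) - 2 * G x) / τ ^ 2

/-- averaging operator -/
noncomputable def Av {k : ℕ} (ξ : Fin k → E) (τ : ℝ) (G : E → ℝ) (x : E) : ℝ :=
  (1 / (2 * (k : ℝ))) * ∑ i, (G (x + τ • ξ i) + G (x - τ • ξ i))

/-- truncated Neumann series -/
noncomputable def Rn {k : ℕ} (ξ : Fin k → E) (τ β : ℝ) : ℕ → (E → ℝ) → E → ℝ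
  | 0, _ => fun _ => 0
  | (n + 1), G => fun x => (1 - β) * G x + β * Av ξ τ (Rn ξ τ β n G) x

theorem Av_abs_le {k : ℕ} (hk : 1 ≤ k) (ξ : Fin k → E) (τ : ℝ) (G : E → ℝ) (B : ℝ)
    (hG : ∀ x, |G x| ≤ B) (x : E) : |Av ξ τ G x| ≤ B := by
  have hk' : (0 : ℝ) < k := by exact_mod_cast hk
  unfold Av
  rw [abs_mul, abs_of_pos (by positivity : (0 : ℝ) < 1 / (2 * (k : ℝ)))]
  have : |∑ i, (G (x + τ • ξ i) + G (x - τ • ξ i))| ≤ ∑ i : Fin k, 2 * B := by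
    refine (Finset.abs_sum_le_sum_abs _ _).trans (Finset.sum_le_sum fun i _ => ?_)
    refine (abs_add_le _ _).trans ?_
    linarith [hG (x + τ • ξ i), hG (x - τ • ξ i)]
  rw [Finset.sum_const, Finset.card_univ, Fintype.card_fin, nsmul_eq_mul] at this
  calc _ ≤ 1 / (2 * (k : ℝ)) * (k * (2 * B)) := by gcongr
    _ = B := by field_simp

theorem Av_sub {k : ℕ} (ξ : Fin k → E) (τ : ℝ) (G G' : E → ℝ) (x : E) :
    Av ξ τ (fun y => G y - G' y) x = Av ξ τ G x - Av ξ τ G' x := by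
  unfold Av
  rw [← mul_sub, ← Finset.sum_sub_distrib]
  congr 1
  exact Finset.sum_congr rfl fun i _ => by ring

theorem Lt_eq {k : ℕ} (hk : 1 ≤ k) (ξ : Fin k → E) (τ : ℝ) (hτ : 0 < τ) (G : E → ℝ) (x : E) :
    Lt ξ τ G x = (Av ξ τ G x - G x) / (τ ^ 2 / (2 * k)) := by
  have hk' : (0 : ℝ) < k := by exact_mod_cast hk
  unfold Lt Av
  rw [← Finset.sum_div, Finset.sum_sub_distrib, Finset.sum_const, Finset.card_univ,
    Fintype.card_fin, nsmul_eq_mul]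
  field_simp

theorem Rn_diff {k : ℕ} (hk : 1 ≤ k) (ξ : Fin k → E) (τ β : ℝ) (hβ0 : 0 ≤ β) (hβ1 : β ≤ 1)
    (G : E → ℝ) (B : ℝ) (hG : ∀ x, |G x| ≤ B) (n : ℕ) :
    ∀ x, |Rn ξ τ β (n + 1) G x - Rn ξ τ β n G x| ≤ β ^ n * B := by
  induction n with
  | zero =>
    intro x
    have hB : 0 ≤ B := (abs_nonneg _).trans (hG x)
    simp only [Rn, Av, add_zero, Finset.sum_const_zero, mul_zero, sub_zero, pow_zero, one_mul]
    rw [abs_mul, abs_of_nonneg (by linarith)]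
    nlinarith [hG x]
  | succ n ih =>
    intro x
    have : Rn ξ τ β (n + 1 + 1) G x - Rn ξ τ β (n + 1) G x =
        β * Av ξ τ (fun y => Rn ξ τ β (n + 1) G y - Rn ξ τ β n G y) x := by
      rw [Av_sub]
      rw [show Rn ξ τ β (n + 1 + 1) G x = (1 - β) * G x + β * Av ξ τ (Rn ξ τ β (n+1) G) x from rfl,
       show Rn ξ τ β (n + 1) G x = (1 - β) * G x + β * Av ξ τ (Rn ξ τ β n G) x from rfl]
      ring
    rw [this, abs_mul, abs_of_nonneg hβ0, pow_succ]
    have := Av_abs_le hk ξ τ _ _ ih x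
    nlinarith

theorem Rn_rep {k : ℕ} (hk : 1 ≤ k) (ξ : Fin k → E) (τ β : ℝ) (hβ0 : 0 ≤ β) (hβ1 : β ≤ 1)
    (n : ℕ) : ∃ (ι : Type) (_ : Fintype ι) (α : ι → ℝ) (t : ι → E), (∀ j, 0 ≤ α j) ∧
      ∑ j, α j ≤ 1 ∧ ∀ G x, Rn ξ τ β n G x = ∑ j, α j * G (x + t j) := by
  have hk' : (0 : ℝ) < k := by exact_mod_cast hk
  induction n with
  | zero => exact ⟨Empty, inferInstance, fun _ => 0, fun _ => 0, by simp, by simp, by simp [Rn]⟩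
  | succ n ih =>
    obtain ⟨ι, _, α, t, h0, h1, hr⟩ := ih
    refine ⟨Option ((Fin k × ι) ⊕ (Fin k × ι)), inferInstance,
      fun o => o.elim (1 - β) (Sum.elim (fun p => β / (2 * k) * α p.2)
        (fun p => β / (2 * k) * α p.2)),
      fun o => o.elim 0 (Sum.elim (fun p => τ • ξ p.1 + t p.2) (fun p => - (τ • ξ p.1) + t p.2)),
      ?_, ?_, ?_⟩
    · rintro (_ | ⟨i, j⟩ | ⟨i, j⟩)
      · simpa using hβ1
      · exact mul_nonneg (by positivity) (h0 _)
      · exact mul_nonneg (by positivity) (h0 _)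
    · simp only [Fintype.sum_option, Option.elim, Fintype.sum_sum_type, Sum.elim_inl,
        Sum.elim_inr, Fintype.sum_prod_type, ← Finset.mul_sum, Finset.sum_const,
        Finset.card_univ, Fintype.card_fin, nsmul_eq_mul]
      have : β / (2 * k) * (k * ∑ j, α j) + β / (2 * k) * (k * ∑ j, α j) = β * ∑ j, α j := by
        field_simp; ring
      rw [this]
      nlinarith
    · intro G x
      simp only [Fintype.sum_option, Option.elim, Fintype.sum_sum_type, Sum.elim_inl,
        Sum.elim_inr, Fintype.sum_prod_type]
      simp only [Rn, Av, hr, add_zero]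
      congr 1
      rw [Finset.sum_add_distrib, ← mul_assoc, mul_add, Finset.mul_sum, Finset.mul_sum]
      congr 1
      · refine Finset.sum_congr rfl fun i _ => ?_
        rw [Finset.mul_sum]
        refine Finset.sum_congr rfl fun j _ => ?_
        rw [show x + τ • ξ i + t j = x + (τ • ξ i + t j) by abel]; ring
      · refine Finset.sum_congr rfl fun i _ => ?_
        rw [Finset.mul_sum]
        refine Finset.sum_congr rfl fun j _ => ?_
        rw [show x - τ • ξ i + t j = x + (-(τ • ξ i) + t j) by abel]; ring

theorem Lt_rep {k : ℕ} (ξ : Fin k → E) (τ : ℝ) {ι : Type} [Fintype ι] (α : ι → ℝ) (t : ι → E)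
    (G : E → ℝ) (x : E) : Lt ξ τ (fun y => ∑ j, α j * G (y + t j)) x =
      ∑ j, α j * Lt ξ τ G (x + t j) := by
  unfold Lt
  simp only [Finset.mul_sum]
  rw [Finset.sum_comm]
  refine Finset.sum_congr rfl fun i _ => ?_
  rw [← Finset.sum_add_distrib, ← Finset.sum_sub_distrib, Finset.sum_div]
  refine Finset.sum_congr rfl fun j _ => ?_
  rw [show x + τ • ξ i + t j = x + t j + τ • ξ i by abel,
    show x - τ • ξ i + t j = x + t j - τ • ξ i by abel]
  ring

theorem exists_resolvent {k : ℕ} (hk : 1 ≤ k) (ξ : Fin k → E) (τ : ℝ) (hτ : 0 < τ) (s : ℝ)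
    (hs : 0 < s) (tol : ℝ) (htol : 0 < tol) :
    ∃ (ι : Type) (_ : Fintype ι) (α : ι → ℝ) (t : ι → E), (∀ j, 0 ≤ α j) ∧
      ∑ j, α j ≤ 1 ∧ ∀ (G : E → ℝ) (B : ℝ), (∀ x, |G x| ≤ B) → ∀ x,
        |∑ j, α j * G (x + t j) - G x - s * ∑ j, α j * Lt ξ τ G (x + t j)| ≤ tol * B := by
  have hk' : (0 : ℝ) < k := by exact_mod_cast hk
  set κ : ℝ := τ ^ 2 / (2 * k) with hκ
  have hκ0 : 0 < κ := by positivity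
  set β : ℝ := s / (κ + s) with hβ
  have hβ0 : 0 ≤ β := by positivity
  have h1β : 1 - β = κ / (κ + s) := by rw [hβ]; field_simp; ring
  have h1β0 : 0 < 1 - β := by rw [h1β]; positivity
  obtain ⟨n, hn⟩ := exists_pow_lt_of_lt_one (mul_pos htol h1β0) (by linarith : β < 1)
  obtain ⟨ι, hι, α, t, h0, h1, hr⟩ := Rn_rep hk ξ τ β hβ0 (by linarith) n
  refine ⟨ι, hι, α, t, h0, h1, fun G B hG x => ?_⟩
  have hB : 0 ≤ B := (abs_nonneg _).trans (hG x)
  have hR : (fun y => ∑ j, α j * G (y + t j)) = Rn ξ τ β n G := by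
    funext y; rw [hr]
  rw [← Lt_rep, hR, ← hr, Lt_eq hk ξ τ hτ, ← hκ]
  have hd := Rn_diff hk ξ τ β hβ0 (by linarith) G B hG n x
  have hrec : Rn ξ τ β (n + 1) G x = (1 - β) * G x + β * Av ξ τ (Rn ξ τ β n G) x := rfl
  have key : Rn ξ τ β n G x - G x - s * ((Av ξ τ (Rn ξ τ β n G) x - Rn ξ τ β n G x) / κ) =
      -(Rn ξ τ β (n + 1) G x - Rn ξ τ β n G x) / (1 - β) := by
    rw [eq_div_iff h1β0.ne', hrec, h1β, hβ]
    field_simp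
    ring
  rw [key, abs_div, abs_neg, abs_of_pos h1β0, div_le_iff₀ h1β0]
  nlinarith
end Resolvent

section Mollify
open MeasureTheory
variable {E : Type*} [NormedAddCommGroup E] [InnerProductSpace ℝ E] [FiniteDimensional ℝ E]
  [MeasurableSpace E] [BorelSpace E]

/-- mollification -/
noncomputable def Mol (η : ContDiffBump (0 : E)) (f : E → ℝ) : E → ℝ :=
  MeasureTheory.convolution (η.normed volume) f (ContinuousLinearMap.lsmul ℝ ℝ) volume

theorem Mol_contDiff (η : ContDiffBump (0 : E)) {f : E → ℝ} (hf : Continuous f) :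
    ContDiff ℝ 4 (Mol η f) :=
  HasCompactSupport.contDiff_convolution_left (n := 4) _ η.hasCompactSupport_normed
    η.contDiff_normed hf.locallyIntegrable

theorem Mol_compact (η : ContDiffBump (0 : E)) {f : E → ℝ} (hf : HasCompactSupport f) :
    HasCompactSupport (Mol η f) :=
  HasCompactSupport.convolution _ η.hasCompactSupport_normed hf

theorem Mol_close (η : ContDiffBump (0 : E)) {f : E → ℝ} (hf : Continuous f) (δ : ℝ)
    (h : ∀ x y, dist x y < η.rOut → dist (f x) (f y) ≤ δ) (x : E) : |Mol η f x - f x| ≤ δ :=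
  η.dist_normed_convolution_le hf.aestronglyMeasurable fun y hy => h y x hy

theorem Mol_apply (η : ContDiffBump (0 : E)) (f : E → ℝ) (x : E) :
    Mol η f x = ∫ z, η.normed volume z * f (x - z) := by
  rfl

theorem Mol_int (η : ContDiffBump (0 : E)) {f : E → ℝ} (hf : Continuous f) (x : E) :
    Integrable (fun z => η.normed volume z * f (x - z)) := by
  apply Continuous.integrable_of_hasCompactSupport
  · exact η.continuous_normed.mul (hf.comp (continuous_const.sub continuous_id))
  · exact η.hasCompactSupport_normed.mul_right

theorem Mol_avg (η : ContDiffBump (0 : E)) {f : E → ℝ} (hf : Continuous f) {ι : Type} [Fintype ι]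
    (α : ι → ℝ) (t : ι → E) (d : ℝ) (h : ∀ y, f y ≤ ∑ j, α j * f (y + t j) + d) (x : E) :
    Mol η f x ≤ ∑ j, α j * Mol η f (x + t j) + d := by
  have e1 : ∑ j, α j * Mol η f (x + t j) + d =
      ∫ z, (∑ j, α j * (η.normed volume z * f (x + t j - z)) + d * η.normed volume z) := by
    rw [integral_add, integral_finset_sum, integral_const_mul, η.integral_normed, mul_one]
    · simp only [integral_const_mul, Mol_apply]
    · exact fun j _ => (Mol_int η hf _).const_mul _
    · exact integrable_finset_sum _ fun j _ => (Mol_int η hf _).const_mul _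
    · exact η.integrable_normed.const_mul _
  rw [e1, Mol_apply]
  refine integral_mono (Mol_int η hf x) ?_ fun z => ?_
  · exact (integrable_finset_sum _ fun j _ => (Mol_int η hf _).const_mul _).add
      (η.integrable_normed.const_mul _)
  · have h0 := η.nonneg_normed (μ := volume) z
    have h1 := mul_le_mul_of_nonneg_left (h (x - z)) h0
    refine h1.trans (le_of_eq ?_)
    rw [mul_add, Finset.mul_sum, mul_comm d]
    congr 1
    refine Finset.sum_congr rfl fun j _ => ?_
    rw [show x - z + t j = x + t j - z by abel]; ring

theorem wsum_le {ι : Type} [Fintype ι] {α : ι → ℝ} (h0 : ∀ j, 0 ≤ α j) (h1 : ∑ j, α j ≤ 1)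
    (a b : ι → ℝ) (e : ℝ) (he : 0 ≤ e) (h : ∀ j, a j ≤ b j + e) :
    ∑ j, α j * a j ≤ ∑ j, α j * b j + e := by
  calc ∑ j, α j * a j ≤ ∑ j, (α j * b j + α j * e) :=
        Finset.sum_le_sum fun j _ => by nlinarith [h0 j, h j]
    _ = ∑ j, α j * b j + (∑ j, α j) * e := by rw [Finset.sum_add_distrib, Finset.sum_mul]
    _ ≤ _ := by nlinarith

theorem hasCompactSupport_sum {ι : Type} (s : Finset ι) (φ : ι → E → ℝ)
    (h : ∀ i, HasCompactSupport (φ i)) : HasCompactSupport (fun y => ∑ i ∈ s, φ i y) := by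
  classical
  induction s using Finset.induction_on with
  | empty =>
    simp only [Finset.sum_empty]
    exact HasCompactSupport.zero
  | insert a s ha ih =>
    simp only [Finset.sum_insert ha]
    exact (h a).add ih

theorem mollify_sub {k : ℕ} (hk : 1 ≤ k) (ξ : Fin k → E) (hξ : ∀ i, ‖ξ i‖ = 1) (f : E → ℝ)
    (hf : Continuous f) (hfc : HasCompactSupport f) (c : ℝ)
    (hsub : ∀ (x : E) (φ : E → ℝ), ContDiff ℝ 2 φ → (∀ y, f y - φ y ≤ f x - φ x) →
      c ≤ ∑ i, D2 φ x (ξ i)) (η : ContDiffBump (0 : E)) (x : E) :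
    c ≤ ∑ i, D2 (Mol η f) x (ξ i) := by
  have hk' : (0 : ℝ) < k := by exact_mod_cast hk
  set F := Mol η f with hF
  have hF4 : ContDiff ℝ 4 F := Mol_contDiff η hf
  have hFc : HasCompactSupport F := Mol_compact η hfc
  set G : E → ℝ := fun y => ∑ i, D2 F y (ξ i) with hG
  have hG2 : ContDiff ℝ 2 G := ContDiff.sum fun i _ => D2_contDiff hF4 _
  have hGc : HasCompactSupport G := hasCompactSupport_sum _ _ fun i => D2_compact hFc _
  obtain ⟨BF, hBF⟩ := hF4.continuous.bounded_above_of_compact_support hFc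
  obtain ⟨BG, hBG⟩ := hG2.continuous.bounded_above_of_compact_support hGc
  obtain ⟨C, hC⟩ := (continuous_finset_sum Finset.univ
    fun i _ => D2_continuous hG2 (ξ i)).bounded_above_of_compact_support
      (hasCompactSupport_sum Finset.univ (fun i x => D2 G x (ξ i)) fun i => D2_compact hGc _)
  have hBF0 : 0 ≤ BF := (norm_nonneg _).trans (hBF 0)
  have hBG0 : 0 ≤ BG := (norm_nonneg _).trans (hBG 0)
  have hC0 : 0 ≤ C := (norm_nonneg _).trans (hC 0)
  -- discretisation error
  have disc : ∀ (w : E → ℝ), ContDiff ℝ 2 w → HasCompactSupport w → ∀ e > 0,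
      ∀ᶠ τ in 𝓝[>] (0 : ℝ), ∀ x, |Lt ξ τ w x - ∑ i, D2 w x (ξ i)| ≤ e := by
    intro w hw hwc e he
    have h := eventually_all.2 fun i : Fin k =>
      second_diff w hw hwc (e / k) (by positivity) (ξ i) (hξ i)
    filter_upwards [h] with τ hτ x
    unfold Lt
    rw [← Finset.sum_sub_distrib]
    refine (Finset.abs_sum_le_sum_abs _ _).trans ?_
    refine (Finset.sum_le_sum fun i _ => hτ i x).trans ?_
    rw [Finset.sum_const, Finset.card_univ, Fintype.card_fin, nsmul_eq_mul]
    exact le_of_eq (by field_simp)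
  suffices H : ∀ e > 0, c ≤ G x + 8 * e by
    refine le_of_forall_pos_le_add fun e he => ?_
    have := H (e / 8) (by positivity)
    linarith
  intro e he
  obtain ⟨s, hs0, hs1, hsC⟩ : ∃ s : ℝ, 0 < s ∧ s ≤ 1 ∧ s * (C + 1) ≤ e := by
    refine ⟨min 1 (e / (C + 1)), by positivity, min_le_left _ _, ?_⟩
    rw [← le_div_iff₀ (by positivity)]; exact min_le_right _ _
  have hse : 0 < s * e := by positivity
  obtain ⟨b, hb, hbf⟩ := Metric.uniformContinuous_iff.1
    (hfc.uniformContinuous_of_continuous hf) (s * e) hse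
  set ηb : ContDiffBump (0 : E) := ⟨b / 2, b, by positivity, by linarith⟩ with hηb
  set w := Mol ηb f with hw
  have hw4 : ContDiff ℝ 4 w := Mol_contDiff ηb hf
  have hw2 : ContDiff ℝ 2 w := hw4.of_le (by norm_num)
  have hF2 : ContDiff ℝ 2 F := hF4.of_le (by norm_num)
  have hwc : HasCompactSupport w := Mol_compact ηb hfc
  have hwf : ∀ y, |w y - f y| ≤ s * e :=
    Mol_close ηb hf (s * e) fun x y hxy => (hbf hxy).le
  obtain ⟨Bw, hBw⟩ := hw4.continuous.bounded_above_of_compact_support hwc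
  have hBw0 : 0 ≤ Bw := (norm_nonneg _).trans (hBw 0)
  obtain ⟨τ, ⟨⟨hτw, hτF⟩, hτG⟩, hτ⟩ := (((disc w hw2 hwc e he).and (disc F hF2 hFc e he)).and
    (disc G hG2 hGc 1 one_pos)).and self_mem_nhdsWithin |>.exists
  have hS : 0 < Bw + BF + BG + 1 := by positivity
  obtain ⟨ι, _, α, t, h0, h1, hres⟩ := exists_resolvent hk ξ τ hτ s hs0
    (s * e / (Bw + BF + BG + 1)) (by positivity)
  have tolB : ∀ B, B ≤ Bw + BF + BG + 1 → s * e / (Bw + BF + BG + 1) * B ≤ s * e := by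
    intro B hB
    rw [div_mul_eq_mul_div, div_le_iff₀ hS]
    exact mul_le_mul_of_nonneg_left hB hse.le
  have rw' := fun y => (hres w Bw hBw y).trans (tolB _ (by linarith))
  have rF := (hres F BF hBF x).trans (tolB _ (by linarith))
  have rG := (hres G BG hBG x).trans (tolB _ (by linarith))
  -- step 1
  set h : E → ℝ := fun y => ∑ j, α j * w (y + t j) with hh
  have hjC : ∀ j, ContDiff ℝ 2 (fun y => w (y + t j)) := fun j =>
    hw2.comp (contDiff_id.add contDiff_const)
  have hjC' : ∀ j, ContDiff ℝ 2 (fun y => α j * w (y + t j)) := fun j =>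
    contDiff_const.mul (hjC j)
  have hhC : ContDiff ℝ 2 h := ContDiff.sum fun j _ => hjC' j
  have hhc : HasCompactSupport h := by
    refine hasCompactSupport_sum _ _ fun j => ?_
    exact (hwc.comp_homeomorph (Homeomorph.addRight (t j))).mul_left (f := fun _ => α j)
  have hD2h : ∀ y, ∑ i, D2 h y (ξ i) = ∑ j, α j * ∑ i, D2 w (y + t j) (ξ i) := by
    intro y
    simp only [Finset.mul_sum]
    rw [Finset.sum_comm]
    refine Finset.sum_congr rfl fun i _ => ?_
    rw [hh, D2_sum _ _ hjC']
    refine Finset.sum_congr rfl fun j _ => ?_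
    rw [D2_const_mul (hjC j).contDiffAt, D2_comp_add]
  obtain ⟨xs, hxs⟩ := (hf.sub hhC.continuous).exists_forall_ge_of_hasCompactSupport
    (hfc.sub hhc)
  have s1 := hsub xs h hhC hxs
  rw [hD2h] at s1
  have s2 := wsum_le h0 h1 (fun j => ∑ i, D2 w (xs + t j) (ξ i)) (fun j => Lt ξ τ w (xs + t j)) e
    he.le fun j => by have := abs_le.1 (hτw (xs + t j)); linarith [this.1]
  have s3 : ∀ y, f y ≤ ∑ j, α j * f (y + t j) + (4 * (s * e) - s * c) := by
    intro y
    have a1 := hxs y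
    have a2 := (abs_le.1 (rw' xs)).1
    have a3 := (abs_le.1 (hwf xs)).1
    have a4 := wsum_le h0 h1 (fun j => w (y + t j)) (fun j => f (y + t j)) (s * e) hse.le
      fun j => by have := (abs_le.1 (hwf (y + t j))).2; linarith
    have a5 : s * c ≤ s * (∑ j, α j * Lt ξ τ w (xs + t j) + e) :=
      mul_le_mul_of_nonneg_left (s1.trans s2) hs0.le
    simp only [Pi.sub_apply] at a1
    have a6 : h xs = ∑ j, α j * w (xs + t j) := rfl
    have a7 : h y = ∑ j, α j * w (y + t j) := rfl
    linarith
  have s4 := Mol_avg η hf α t _ s3 x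
  rw [← hF] at s4
  have s5 := wsum_le h0 h1 (fun j => Lt ξ τ F (x + t j)) (fun j => G (x + t j)) e
    he.le fun j => by have := abs_le.1 (hτF (x + t j)); simp only [hG]; linarith [this.2]
  have s6 := wsum_le h0 h1 (fun j => Lt ξ τ G (x + t j)) (fun j => 0) (C + 1)
    (by positivity) fun j => by
      have := abs_le.1 (hτG (x + t j))
      have h2 := abs_le.1 (hC (x + t j))
      linarith [this.2, h2.2]
  simp only [mul_zero, Finset.sum_const_zero, zero_add] at s6
  have s7 := (abs_le.1 rF).2
  have s8 := (abs_le.1 rG).2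
  have s9 : s * ∑ j, α j * Lt ξ τ G (x + t j) ≤ e :=
    (mul_le_mul_of_nonneg_left s6 hs0.le).trans hsC
  have s10 : s * e ≤ e := by nlinarith
  have s11 : ∑ j, α j * G (x + t j) ≤ G x + 2 * e := by linarith
  have s12 : s * ∑ j, α j * Lt ξ τ F (x + t j) ≤ s * (G x + 3 * e) :=
    mul_le_mul_of_nonneg_left (by linarith) hs0.le
  have s13 : s * c ≤ s * (G x + 8 * e) := by nlinarith
  exact le_of_mul_le_mul_left s13 hs0
end Mollify

section SupConv
variable {E : Type*} [NormedAddCommGroup E] [InnerProductSpace ℝ E]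
open scoped RealInnerProductSpace

/-- sup-convolution data -/
structure IsSC (K : Set E) (g : E → ℝ) (a : ℝ) (V : E → ℝ) (Y : E → E) : Prop where
  mem : ∀ x, Y x ∈ K
  eq : ∀ x, V x = g (Y x) - a * ‖x - Y x‖ ^ 2
  le : ∀ x, ∀ y ∈ K, g y - a * ‖x - y‖ ^ 2 ≤ V x

theorem exists_SC {K : Set E} (hK : IsCompact K) (hne : K.Nonempty) {g : E → ℝ}
    (hg : UpperSemicontinuousOn g K) (a : ℝ) : ∃ V Y, IsSC K g a V Y := by
  have h : ∀ x : E, ∃ y ∈ K, ∀ z ∈ K, g z - a * ‖x - z‖ ^ 2 ≤ g y - a * ‖x - y‖ ^ 2 := by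
    intro x
    have hu : UpperSemicontinuousOn (fun z => g z + (- (a * ‖x - z‖ ^ 2))) K := by
      refine hg.add (Continuous.upperSemicontinuous ?_ |>.upperSemicontinuousOn _)
      fun_prop
    obtain ⟨y, hy, hm⟩ := hu.exists_isMaxOn hne hK
    refine ⟨y, hy, fun z hz => ?_⟩
    have := hm hz
    simp only [mem_ofPred_eq] at this
    linarith
  choose Y hY hm using h
  exact ⟨fun x => g (Y x) - a * ‖x - Y x‖ ^ 2, Y, hY, fun _ => rfl, hm⟩

theorem IsSC.continuous {K : Set E} (hK : IsCompact K) {g : E → ℝ} {a : ℝ} (ha : 0 < a)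
    {V : E → ℝ} {Y : E → E} (h : IsSC K g a V Y) : Continuous V := by
  obtain ⟨R, hR⟩ := hK.isBounded.exists_norm_le
  rw [continuous_iff_continuousAt]
  intro x
  have hn : ∀ x', |V x' - V x| ≤ a * (‖x' - x‖ * (‖x' - x‖ + 2 * (‖x‖ + R))) := by
    intro x'
    have hYx := hR _ (h.mem x)
    have hYx' := hR _ (h.mem x')
    have key : ∀ y, ‖y‖ ≤ R → |‖x' - y‖ ^ 2 - ‖x - y‖ ^ 2| ≤
        ‖x' - x‖ * (‖x' - x‖ + 2 * (‖x‖ + R)) := by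
      intro y hy
      have e1 : |‖x' - y‖ - ‖x - y‖| ≤ ‖x' - x‖ := by
        have := abs_norm_sub_norm_le (x' - y) (x - y)
        rwa [sub_sub_sub_cancel_right] at this
      have e2 : ‖x - y‖ ≤ ‖x‖ + R := (norm_sub_le _ _).trans (by linarith)
      have e3 : |‖x' - y‖ + ‖x - y‖| ≤ ‖x' - x‖ + 2 * (‖x‖ + R) := by
        rw [abs_of_nonneg (by positivity)]
        linarith [(abs_le.1 e1).2]
      have : ‖x' - y‖ ^ 2 - ‖x - y‖ ^ 2 = (‖x' - y‖ - ‖x - y‖) * (‖x' - y‖ + ‖x - y‖) := by ring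
      rw [this, abs_mul]
      exact mul_le_mul e1 e3 (abs_nonneg _) (norm_nonneg _)
    have k1 := mul_le_mul_of_nonneg_left (key _ hYx) ha.le
    have k2 := mul_le_mul_of_nonneg_left (key _ hYx') ha.le
    have a1 := h.le x _ (h.mem x')
    have a2 := h.le x' _ (h.mem x)
    have b1 := h.eq x
    have b2 := h.eq x'
    have c1 := mul_le_mul_of_nonneg_left (le_abs_self (‖x' - Y x‖ ^ 2 - ‖x - Y x‖ ^ 2)) ha.le
    have c2 := mul_le_mul_of_nonneg_left (neg_abs_le (‖x' - Y x'‖ ^ 2 - ‖x - Y x'‖ ^ 2)) ha.le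
    rw [abs_le]
    constructor <;> nlinarith
  have ht : Tendsto (fun x' => a * (‖x' - x‖ * (‖x' - x‖ + 2 * (‖x‖ + R)))) (𝓝 x) (𝓝 0) := by
    have : Continuous (fun x' => a * (‖x' - x‖ * (‖x' - x‖ + 2 * (‖x‖ + R)))) := by fun_prop
    simpa using this.tendsto x
  have h2 : Tendsto (fun x' => V x' - V x) (𝓝 x) (𝓝 0) :=
    squeeze_zero_norm (fun x' => by rw [Real.norm_eq_abs]; exact hn x') ht
  have h3 := h2.add_const (V x)
  simpa [ContinuousAt] using h3

/-- expansion identity -/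
theorem sq_expand (a : ℝ) (x x' y : E) : a * ‖x - y‖ ^ 2 - a * ‖x' - y‖ ^ 2 =
    ⟪(2 * a) • (y - x), x' - x⟫ - a * ‖x' - x‖ ^ 2 := by
  have : x' - y = (x' - x) - (y - x) := by abel
  rw [this, norm_sub_sq_real (x' - x) (y - x), real_inner_smul_left, real_inner_comm,
    norm_sub_rev y x]
  ring

theorem IsSC.lower {K : Set E} {g : E → ℝ} {a : ℝ} {V : E → ℝ} {Y : E → E} (h : IsSC K g a V Y)
    (x x' : E) : V x + ⟪(2 * a) • (Y x - x), x' - x⟫ - a * ‖x' - x‖ ^ 2 ≤ V x' := by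
  have h1 := h.le x' _ (h.mem x)
  have h2 := h.eq x
  have h3 := sq_expand a x x' (Y x)
  linarith

theorem IsSC.tendsto {K : Set E} {g : E → ℝ} {a : ℝ} (ha : 0 < a) {V : E → ℝ} {Y : E → E}
    (h : IsSC K g a V Y) {x0 yh p : E} (hp : p = (2 * a) • (yh - x0))
    (hlo : ∀ x, V x0 + ⟪p, x - x0⟫ - a * ‖x - x0‖ ^ 2 ≤ V x)
    (hup : ∀ x, V x ≤ V x0 + ⟪p, x - x0⟫ + a * ‖x - x0‖ ^ 2) :
    Tendsto (fun x => (2 * a) • (Y x - x)) (𝓝 x0) (𝓝 p) ∧ Tendsto Y (𝓝 x0) (𝓝 yh) := by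
  have hq : ∀ x, ‖(2 * a) • (Y x - x) - p‖ ≤ 6 * a * ‖x - x0‖ := by
    intro x
    set q := (2 * a) • (Y x - x) with hqd
    set d := q - p with hd
    set t : ℝ := 1 / (6 * a) with ht
    have h1 := h.lower x (x + t • d)
    rw [← hqd] at h1
    have h2 := hup (x + t • d)
    have h3 := hlo x
    have e1 : x + t • d - x = t • d := by abel
    have e2 : x + t • d - x0 = (x - x0) + t • d := by abel
    rw [e1] at h1
    rw [e2, inner_add_right] at h2
    have e3 : ⟪q, t • d⟫ - ⟪p, t • d⟫ = t * ‖d‖ ^ 2 := by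
      rw [← inner_sub_left, ← hd, inner_smul_right, real_inner_self_eq_norm_sq]
    have e4 : ‖t • d‖ = t * ‖d‖ := by
      rw [norm_smul, Real.norm_of_nonneg (by positivity)]
    have e5 : ‖x - x0 + t • d‖ ^ 2 ≤ 2 * ‖x - x0‖ ^ 2 + 2 * (t * ‖d‖) ^ 2 := by
      have := norm_add_le (x - x0) (t • d)
      rw [e4] at this
      have h0 := norm_nonneg (x - x0 + t • d)
      nlinarith [sq_nonneg (‖x - x0‖ - t * ‖d‖)]
    have e6 := mul_le_mul_of_nonneg_left e5 ha.le
    rw [e4] at h1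
    have e7 : t * ‖d‖ ^ 2 ≤ a * (3 * ‖x - x0‖ ^ 2 + 3 * (t * ‖d‖) ^ 2) := by nlinarith
    have e8 : ‖d‖ = 6 * a * (t * ‖d‖) := by rw [ht]; field_simp
    set s := t * ‖d‖ with hs
    have e9 : t * ‖d‖ ^ 2 = 6 * a * s ^ 2 := by
      have : t * ‖d‖ ^ 2 = s * ‖d‖ := by rw [hs]; ring
      rw [this, e8]; ring
    have e10 : s ^ 2 ≤ ‖x - x0‖ ^ 2 := by
      rw [e9] at e7
      have : a * s ^ 2 ≤ a * ‖x - x0‖ ^ 2 := by nlinarith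
      exact le_of_mul_le_mul_left this ha
    have e11 : s ≤ ‖x - x0‖ := le_of_sq_le_sq e10 (norm_nonneg _)
    rw [e8]
    exact mul_le_mul_of_nonneg_left e11 (by positivity)
  have t1 : Tendsto (fun x => 6 * a * ‖x - x0‖) (𝓝 x0) (𝓝 0) := by
    have : Continuous fun x => 6 * a * ‖x - x0‖ := by fun_prop
    simpa using this.tendsto x0
  have t2 : Tendsto (fun x => (2 * a) • (Y x - x)) (𝓝 x0) (𝓝 p) := by
    have := (squeeze_zero_norm hq t1).add_const p
    simpa using this
  refine ⟨t2, ?_⟩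
  have t3 := (t2.const_smul (2 * a)⁻¹).add (tendsto_id (x := 𝓝 x0))
  have ha2 : (2 * a) ≠ 0 := by positivity
  rw [hp] at t3
  simpa only [smul_smul, inv_mul_cancel₀ ha2, one_smul, id, sub_add_cancel] using t3

/-- touching transfer -/
theorem IsSC.touch [CompleteSpace E] {K : Set E} {g : E → ℝ} {a : ℝ} {V : E → ℝ} {Y : E → E}
    (h : IsSC K g a V Y) {φ : E → ℝ} {x : E} (hφ : DifferentiableAt ℝ φ x)
    (hm : IsLocalMax (fun y => V y - φ y) x) :
    IsLocalMaxOn (fun y => g y - φ (y + (x - Y x))) K (Y x) ∧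
    gradient φ x = (2 * a) • (Y x - x) := by
  constructor
  · have ht : Tendsto (fun y => y + (x - Y x)) (𝓝 (Y x)) (𝓝 x) := by
      have : Continuous (fun y => y + (x - Y x)) := by fun_prop
      simpa using this.tendsto (Y x)
    have := ht.eventually hm
    filter_upwards [mem_nhdsWithin_of_mem_nhds this, self_mem_nhdsWithin] with y hy hyK
    have h1 := h.le (y + (x - Y x)) y hyK
    have h2 := h.eq x
    simp only [add_sub_cancel, add_sub_cancel_left] at *
    linarith
  · set q := (2 * a) • (Y x - x) with hq
    have hmin : IsLocalMin (fun y => φ y - ⟪q, y⟫ + a * ‖y - x‖ ^ 2) x := by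
      filter_upwards [hm] with y hy
      have h1 := h.lower x y
      rw [← hq, inner_sub_right] at h1
      simp only [sub_self, norm_zero]
      norm_num
      linarith
    have hd : HasFDerivAt (fun y => φ y - ⟪q, y⟫ + a * ‖y - x‖ ^ 2)
        (fderiv ℝ φ x - innerSL ℝ q) x := by
      have d1 := hφ.hasFDerivAt
      have d2 : HasFDerivAt (fun y => ⟪q, y⟫) (innerSL ℝ q) x := (innerSL ℝ q).hasFDerivAt
      have d3 : HasFDerivAt (fun y => a * ‖y - x‖ ^ 2) (0 : E →L[ℝ] ℝ) x := by
        have := (((hasFDerivAt_id x).sub_const x).norm_sq).const_mul a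
        simpa using this
      have d4 := (d1.sub d2).add d3
      rw [add_zero] at d4
      exact d4
    have := hmin.hasFDerivAt_eq_zero hd
    have h2 : fderiv ℝ φ x = innerSL ℝ q := sub_eq_zero.1 this
    refine HasGradientAt.gradient ?_
    rw [hasGradientAt_iff_hasFDerivAt]
    have d5 := hφ.hasFDerivAt
    rw [h2] at d5
    exact d5
end SupConv

section Core
variable {E : Type*} [NormedAddCommGroup E] [InnerProductSpace ℝ E] [FiniteDimensional ℝ E]
  [CompleteSpace E] [MeasurableSpace E] [BorelSpace E]
open scoped RealInnerProductSpace

theorem quad_contDiff (A : ℝ) (p x0 : E) (C : ℝ) :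
    ContDiff ℝ 2 (fun y => A + ⟪p, y - x0⟫ + C * ‖y - x0‖ ^ 2) := by
  have h1 : ContDiff ℝ 2 (fun y : E => y - x0) := contDiff_id.sub contDiff_const
  exact (contDiff_const.add (contDiff_const.inner ℝ h1)).add
    (contDiff_const.mul (h1.norm_sq ℝ))

theorem D2_quad (A : ℝ) (p x0 : E) (C : ℝ) (x ξ : E) :
    D2 (fun y => A + ⟪p, y - x0⟫ + C * ‖y - x0‖ ^ 2) x ξ = 2 * C * ‖ξ‖ ^ 2 := by
  have h1 : fderiv ℝ (fun y => A + ⟪p, y - x0⟫ + C * ‖y - x0‖ ^ 2) =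
      fun y => innerSL ℝ p + C • (2 • innerSL ℝ (y - x0)) := by
    funext y
    have d0 : HasFDerivAt (fun y : E => y - x0) (ContinuousLinearMap.id ℝ E) y :=
      (hasFDerivAt_id y).sub_const x0
    have d2 : HasFDerivAt (fun y => ⟪p, y - x0⟫) (innerSL ℝ p) y := by
      have := ((innerSL ℝ p).hasFDerivAt (x := y - x0)).comp y d0
      rw [ContinuousLinearMap.comp_id] at this
      exact this
    have d3 := (d0.norm_sq).const_mul C
    have d4 := (d2.const_add A).add d3
    refine (HasFDerivAt.fderiv d4).trans ?_
    rfl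
  unfold D2
  rw [h1]
  have d : HasFDerivAt (fun y => innerSL ℝ p + C • (2 • innerSL ℝ (y - x0)))
      (C • (2 • (innerSL ℝ : E →L[ℝ] E →L[ℝ] ℝ))) x := by
    have d0 : HasFDerivAt (fun y : E => innerSL ℝ (y - x0))
      (innerSL ℝ : E →L[ℝ] E →L[ℝ] ℝ) x := by
      have := ((innerSL ℝ : E →L[ℝ] E →L[ℝ] ℝ).hasFDerivAt (x := x - x0)).comp x
        ((hasFDerivAt_id x).sub_const x0)
      rw [ContinuousLinearMap.comp_id] at this
      exact this
    exact ((d0.const_smul (2 : ℕ)).const_smul C).const_add _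
  rw [d.fderiv]
  have h3 : innerSL ℝ ξ ξ = ‖ξ‖ ^ 2 := real_inner_self_eq_norm_sq ξ
  simp only [smul_apply, h3]
  simp
  ring

theorem smooth_approx {k : ℕ} (hk : 1 ≤ k) {V : E → ℝ} (hV : Continuous V) (x0 p : E) {a : ℝ}
    (ha : 0 < a)
    (hup : ∀ x, V x ≤ V x0 + ⟪p, x - x0⟫ + a * ‖x - x0‖ ^ 2) (c r1 : ℝ) (hr1 : 0 < r1)
    (hsub : ∀ x, ‖x - x0‖ < r1 → ∀ φ : E → ℝ, ContDiff ℝ 2 φ → IsLocalMax (fun y => V y - φ y) x →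
      ∀ ξ : Fin k → E, Orthonormal ℝ ξ → c ≤ ∑ i, D2 φ x (ξ i)) :
    ∃ r2 > 0, ∀ δ > 0, ∃ Θ : E → ℝ, ContDiff ℝ 2 Θ ∧
      (∀ x, ∀ ξ : Fin k → E, Orthonormal ℝ ξ → c ≤ ∑ i, D2 Θ x (ξ i)) ∧
      ∀ x, ‖x - x0‖ < r2 → |Θ x - V x| ≤ δ := by
  set C : ℝ := a + 2 / r1 ^ 2 + |c| with hC
  have hC0 : 0 ≤ C := by positivity
  set Q : E → ℝ := fun x => (V x0 - 1) + ⟪p, x - x0⟫ + C * ‖x - x0‖ ^ 2 with hQ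
  have hQC : ContDiff ℝ 2 Q := quad_contDiff _ _ _ _
  have hQD : ∀ (x : E) (ξ : Fin k → E), Orthonormal ℝ ξ → ∑ i, D2 Q x (ξ i) = k * (2 * C) := by
    intro x ξ hξ
    have : ∀ i, D2 Q x (ξ i) = 2 * C := by
      intro i
      rw [hQ, D2_quad, hξ.1 i]; ring
    simp [this]
  set f : E → ℝ := fun x => max (V x - Q x) 0 with hf
  have hfC : Continuous f := (hV.sub hQC.continuous).max continuous_const
  have hpos : ∀ x, 0 < V x - Q x → ‖x - x0‖ < r1 := by
    intro x hx
    have h1 := hup x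
    have h2 : 0 < 1 - (2 / r1 ^ 2 + |c|) * ‖x - x0‖ ^ 2 := by
      simp only [hQ, hC] at hx
      nlinarith
    have h3 : 2 / r1 ^ 2 * ‖x - x0‖ ^ 2 < 1 := by nlinarith [abs_nonneg c, sq_nonneg ‖x - x0‖]
    rw [div_mul_eq_mul_div, div_lt_one (by positivity)] at h3
    exact lt_of_pow_lt_pow_left₀ 2 hr1.le (by nlinarith [sq_nonneg ‖x - x0‖])
  have hfc : HasCompactSupport f := by
    refine HasCompactSupport.intro (isCompact_closedBall x0 r1) fun x hx => ?_
    simp only [mem_closedBall, dist_eq_norm, not_le] at hx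
    refine max_eq_right ?_
    by_contra! h
    exact absurd (hpos x h) (by linarith)
  have hnear : ∀ᶠ x in 𝓝 x0, 0 < V x - Q x := by
    have : 0 < V x0 - Q x0 := by simp [hQ]
    exact ((hV.sub hQC.continuous).tendsto x0).eventually (lt_mem_nhds this)
  obtain ⟨r2, hr2, hb⟩ := Metric.eventually_nhds_iff.1 hnear
  refine ⟨r2, hr2, fun δ hδ => ?_⟩
  obtain ⟨b, hb0, hbf⟩ := Metric.uniformContinuous_iff.1
    (hfc.uniformContinuous_of_continuous hfC) δ hδ
  set η : ContDiffBump (0 : E) := ⟨b / 2, b, by positivity, by linarith⟩ with hη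
  have hM2 : ContDiff ℝ 2 (Mol η f) := (Mol_contDiff η hfC).of_le (by norm_num)
  refine ⟨fun y => Mol η f y + Q y, hM2.add hQC, ?_, ?_⟩
  · intro x ξ hξ
    have hs := mollify_sub hk ξ hξ.1 f hfC hfc (c - k * (2 * C)) ?_ η x
    · simp only [D2_add hM2.contDiffAt hQC.contDiffAt, Finset.sum_add_distrib, hQD x ξ hξ]
      linarith
    · intro x φ hφ hx
      rcases le_or_gt (V x - Q x) 0 with h | h
      · have hfx : f x = 0 := max_eq_right h
        have hmin : IsLocalMin φ x := by
          refine Filter.Eventually.of_forall fun y => ?_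
          have h1 := hx y
          have h2 : 0 ≤ f y := le_max_right _ _
          linarith
        have h3 : 0 ≤ ∑ i, D2 φ x (ξ i) :=
          Finset.sum_nonneg fun i _ => D2_nonneg_of_isLocalMin hφ.contDiffAt hmin _
        have h4 : (1 : ℝ) ≤ k := by exact_mod_cast hk
        have h5 : |c| ≤ C := by
          have : 0 < 2 / r1 ^ 2 := by positivity
          linarith
        nlinarith [le_abs_self c]
      · have hfx : f x = V x - Q x := max_eq_left h.le
        have := hsub x (hpos x h) (fun y => φ y + Q y) (hφ.add hQC) ?_ ξ hξ
        · simp only [D2_add hφ.contDiffAt hQC.contDiffAt, Finset.sum_add_distrib,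
            hQD x ξ hξ] at this
          linarith
        · refine Filter.Eventually.of_forall fun y => ?_
          have h1 := hx y
          have h2 : V y - Q y ≤ f y := le_max_left _ _
          simp only
          linarith
  · intro x hx
    have h1 : f x = V x - Q x := max_eq_left (hb (by rwa [dist_eq_norm])).le
    have h2 := Mol_close η hfC δ (fun x y hxy => (hbf hxy).le) x
    rw [h1] at h2
    have : Mol η f x + Q x - V x = Mol η f x - (V x - Q x) := by ring
    rwa [this]

theorem core {k : ℕ} (hk : 1 ≤ k) {K Ω : Set E} (hK : IsCompact K) (hΩ : IsOpen Ω) (hΩK : Ω ⊆ K)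
    {v u : E → ℝ} (hv : UpperSemicontinuousOn v K) (hu : LowerSemicontinuousOn u K)
    {H : E → E → ℝ} (hH : ContinuousOn (Function.uncurry H) (Ω ×ˢ (univ : Set E))) {μ ρ : ℝ}
    (hsub : ∀ y ∈ Ω, ∀ φ : E → ℝ, ContDiffAt ℝ 2 φ y → IsLocalMaxOn (fun x => v x - φ x) Ω y →
      ∀ ξ : Fin k → E, Orthonormal ℝ ξ →
        0 ≤ ∑ i, D2 φ y (ξ i) + H y (gradient φ y) + ρ * v y)
    (hsup : ∀ z ∈ Ω, ∀ φ : E → ℝ, ContDiffAt ℝ 2 φ z → IsLocalMinOn (fun x => u x - φ x) Ω z →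
      ∀ c, (∀ ξ : Fin k → E, Orthonormal ℝ ξ → c ≤ ∑ i, D2 φ z (ξ i)) →
        c + H z (gradient φ z) + μ * u z ≤ 0)
    {a : ℝ} (ha : 0 < a) {yh zh : E} (hy : yh ∈ Ω) (hz : zh ∈ Ω)
    (hmax : ∀ y ∈ K, ∀ z ∈ K, v y - u z - a / 2 * ‖y - z‖ ^ 2 ≤
      v yh - u zh - a / 2 * ‖yh - zh‖ ^ 2) :
    μ * u zh - ρ * v yh ≤ H yh (a • (yh - zh)) - H zh (a • (yh - zh)) := by
  have hne : K.Nonempty := ⟨yh, hΩK hy⟩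
  obtain ⟨V, Y, hV⟩ := exists_SC hK hne hv a
  have hu' : UpperSemicontinuousOn (fun x => - u x) K := fun x hx b hb => by
    have := hu x hx (-b) (by simp only at hb; linarith)
    filter_upwards [this] with y hy
    linarith
  obtain ⟨W, Z, hW⟩ := exists_SC hK hne hu' a
  have hVc := hV.continuous hK ha
  have hWc := hW.continuous hK ha
  set p := a • (yh - zh) with hp
  set x0 : E := (1 / 2 : ℝ) • (yh + zh) with hx0
  have ey : yh - x0 = (1 / 2 : ℝ) • (yh - zh) := by rw [hx0]; module
  have ez : zh - x0 = -((1 / 2 : ℝ) • (yh - zh)) := by rw [hx0]; module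
  have hpy : p = (2 * a) • (yh - x0) := by
    rw [ey, hp, smul_smul]; congr 1; ring
  have hpz : -p = (2 * a) • (zh - x0) := by
    rw [ez, hp, smul_neg, smul_smul]; congr 2; ring
  have hny : ‖x0 - yh‖ ^ 2 = 1 / 4 * ‖yh - zh‖ ^ 2 := by
    rw [norm_sub_rev, ey, norm_smul]; norm_num; ring
  have hnz : ‖x0 - zh‖ ^ 2 = 1 / 4 * ‖yh - zh‖ ^ 2 := by
    rw [norm_sub_rev, ez, norm_neg, norm_smul]; norm_num; ring
  set M := v yh - u zh - a / 2 * ‖yh - zh‖ ^ 2 with hM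
  have hVW : ∀ x, V x + W x ≤ M := by
    intro x
    have h1 := hmax _ (hV.mem x) _ (hW.mem x)
    rw [hV.eq x, hW.eq x]
    have h2 : ‖Y x - Z x‖ ^ 2 ≤ 2 * ‖x - Y x‖ ^ 2 + 2 * ‖x - Z x‖ ^ 2 := by
      have e : Y x - Z x = (x - Z x) - (x - Y x) := by abel
      have := norm_sub_le (x - Z x) (x - Y x)
      rw [← e] at this
      nlinarith [sq_nonneg (‖x - Z x‖ - ‖x - Y x‖), norm_nonneg (Y x - Z x)]
    have h3 := mul_le_mul_of_nonneg_left h2 ha.le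
    linarith
  have hV0' := hV.le x0 yh (hΩK hy)
  have hW0' := hW.le x0 zh (hΩK hz)
  rw [hny] at hV0'
  rw [hnz] at hW0'
  have hVW0 := hVW x0
  have hV0 : V x0 = v yh - a * ‖x0 - yh‖ ^ 2 := by rw [hny]; linarith
  have hW0 : W x0 = - u zh - a * ‖x0 - zh‖ ^ 2 := by rw [hnz]; linarith
  have hM0 : V x0 + W x0 = M := by rw [hV0, hW0, hny, hnz, hM]; ring
  have hVlo : ∀ x, V x0 + ⟪p, x - x0⟫ - a * ‖x - x0‖ ^ 2 ≤ V x := by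
    intro x
    have h1 := hV.le x yh (hΩK hy)
    have h2 := sq_expand a x0 x yh
    rw [← hpy] at h2
    linarith
  have hWlo : ∀ x, W x0 + ⟪-p, x - x0⟫ - a * ‖x - x0‖ ^ 2 ≤ W x := by
    intro x
    have h1 := hW.le x zh (hΩK hz)
    have h2 := sq_expand a x0 x zh
    rw [← hpz] at h2
    linarith
  have hVup : ∀ x, V x ≤ V x0 + ⟪p, x - x0⟫ + a * ‖x - x0‖ ^ 2 := by
    intro x
    have h1 := hWlo x
    rw [inner_neg_left] at h1
    linarith [hVW x]
  have hWup : ∀ x, W x ≤ W x0 + ⟪-p, x - x0⟫ + a * ‖x - x0‖ ^ 2 := by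
    intro x
    have h1 := hVlo x
    rw [inner_neg_left]
    linarith [hVW x]
  obtain ⟨tq, tY⟩ := hV.tendsto ha hpy hVlo hVup
  obtain ⟨tq', tZ⟩ := hW.tendsto ha hpz hWlo hWup
  have hcont : ∀ y ∈ Ω, ContinuousAt (Function.uncurry H) (y, p) := fun y hy =>
    hH.continuousAt ((hΩ.prod isOpen_univ).mem_nhds ⟨hy, mem_univ _⟩)
  have tH : Tendsto (fun x => H (Y x) ((2 * a) • (Y x - x))) (𝓝 x0) (𝓝 (H yh p)) :=
    (hcont yh hy).tendsto.comp (tY.prodMk_nhds tq)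
  have tq'' : Tendsto (fun x => - ((2 * a) • (Z x - x))) (𝓝 x0) (𝓝 p) := by
    simpa only [neg_neg] using tq'.neg
  have tH' : Tendsto (fun x => H (Z x) (- ((2 * a) • (Z x - x)))) (𝓝 x0) (𝓝 (H zh p)) :=
    (hcont zh hz).tendsto.comp (tZ.prodMk_nhds tq'')
  have tv : Tendsto (fun x => v (Y x)) (𝓝 x0) (𝓝 (v yh)) := by
    have h1 : (fun x => v (Y x)) = fun x => V x + a * ‖x - Y x‖ ^ 2 := by
      funext x; rw [hV.eq x]; ring
    have h2 : v yh = V x0 + a * ‖x0 - yh‖ ^ 2 := by rw [hV0]; ring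
    rw [h1, h2]
    exact (hVc.tendsto x0).add (((tendsto_id.sub tY).norm.pow 2).const_mul a)
  have tu : Tendsto (fun x => u (Z x)) (𝓝 x0) (𝓝 (u zh)) := by
    have h1 : (fun x => u (Z x)) = fun x => -(W x + a * ‖x - Z x‖ ^ 2) := by
      funext x; rw [hW.eq x]; ring
    have h2 : u zh = -(W x0 + a * ‖x0 - zh‖ ^ 2) := by rw [hW0]; ring
    rw [h1, h2]
    exact ((hWc.tendsto x0).add (((tendsto_id.sub tZ).norm.pow 2).const_mul a)).neg
  by_contra! hcon
  obtain ⟨κ, hκ, hgap⟩ : ∃ κ > 0, 4 * κ = μ * u zh - ρ * v yh - (H yh p - H zh p) :=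
    ⟨(μ * u zh - ρ * v yh - (H yh p - H zh p)) / 4, by linarith, by ring⟩
  have hk0 : (0 : ℝ) < k := by exact_mod_cast hk
  set τ : ℝ := κ / (2 * k) with hτ
  have hτ0 : 0 < τ := by positivity
  have hkτ : k * (2 * τ) = κ := by rw [hτ]; field_simp
  set c := - H yh p - ρ * v yh - κ with hc
  -- good neighbourhoods
  have ev1 : ∀ᶠ x in 𝓝 x0, Y x ∈ Ω ∧
      H (Y x) ((2 * a) • (Y x - x)) + ρ * v (Y x) < H yh p + ρ * v yh + κ :=
    (tY.eventually (hΩ.mem_nhds hy)).and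
      ((tH.add (tv.const_mul ρ)).eventually (gt_mem_nhds (by linarith)))
  have ev2 : ∀ᶠ x in 𝓝 x0, Z x ∈ Ω ∧ H zh p + μ * u zh - κ <
      H (Z x) (- ((2 * a) • (Z x - x))) + μ * u (Z x) :=
    (tZ.eventually (hΩ.mem_nhds hz)).and
      ((tH'.add (tu.const_mul μ)).eventually (lt_mem_nhds (by linarith)))
  obtain ⟨r1, hr1, hb1⟩ := Metric.eventually_nhds_iff.1 ev1
  obtain ⟨r3, hr3, hb3⟩ := Metric.eventually_nhds_iff.1 ev2
  obtain ⟨r2, hr2, happ⟩ := smooth_approx hk hVc x0 p ha hVup c r1 hr1 (by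
    intro x hx φ hφ hm ξ hξ
    obtain ⟨hYΩ, hlt⟩ := hb1 (by rwa [dist_eq_norm])
    obtain ⟨h1, h2⟩ := hV.touch (hφ.differentiable (by norm_num) x) hm
    have e : Y x + (x - Y x) = x := by abel
    have hφ' : ContDiff ℝ 2 (fun y => φ (y + (x - Y x))) :=
      hφ.comp (contDiff_id.add contDiff_const)
    have h3 := hsub (Y x) hYΩ _ hφ'.contDiffAt (h1.on_subset hΩK) ξ hξ
    have h4 : gradient (fun y => φ (y + (x - Y x))) (Y x) = gradient φ x := by
      unfold gradient
      rw [fderiv_comp_add_right, e]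
    simp only [D2_comp_add, e, h4, h2] at h3
    linarith)
  set r := min r2 r3 / 2 with hr
  have hr0 : 0 < r := by positivity
  have hrr2 : r < r2 := by
    have := min_le_left r2 r3
    linarith [lt_min hr2 hr3]
  have hrr3 : r < r3 := by
    have := min_le_right r2 r3
    linarith [lt_min hr2 hr3]
  obtain ⟨Θ, hΘ, hΘD, hΘV⟩ := happ (τ * r ^ 2 / 4) (by positivity)
  set q : E → ℝ := fun y => 0 + ⟪(0 : E), y - x0⟫ + (-τ) * ‖y - x0‖ ^ 2 with hq
  have hqC : ContDiff ℝ 2 q := quad_contDiff _ _ _ _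
  set θ : E → ℝ := fun y => Θ y + q y with hθ
  have hθC : ContDiff ℝ 2 θ := hΘ.add hqC
  have hqe : ∀ x, q x = - τ * ‖x - x0‖ ^ 2 := fun x => by simp [hq]
  obtain ⟨xm, hxm, hxmax⟩ := (isCompact_closedBall x0 r).exists_isMaxOn
    ⟨x0, mem_closedBall_self hr0.le⟩ (hWc.add hθC.continuous).continuousOn
  rw [mem_closedBall, dist_eq_norm] at hxm
  have hlt : ‖xm - x0‖ < r := by
    refine lt_of_le_of_ne hxm fun heq => ?_
    have h1 := hxmax (mem_closedBall_self hr0.le)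
    simp only [mem_ofPred_eq, hθ, hqe, Pi.add_apply] at h1
    have h2 := (abs_le.1 (hΘV x0 (by simpa using hr2))).1
    have h3 := (abs_le.1 (hΘV xm (by linarith))).2
    have h4 := hVW xm
    rw [heq] at h1
    simp only [sub_self, norm_zero] at h1
    have : 0 < τ * r ^ 2 := by positivity
    nlinarith
  have hloc : IsLocalMax (fun y => W y - (- θ y)) xm := by
    have : closedBall x0 r ∈ 𝓝 xm :=
      mem_of_superset (isOpen_ball.mem_nhds (by rwa [mem_ball, dist_eq_norm])) ball_subset_closedBall
    filter_upwards [this] with y hy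
    have := hxmax hy
    simp only [mem_ofPred_eq, Pi.add_apply] at this
    linarith
  obtain ⟨h1, h2⟩ := hW.touch ((hθC.neg).differentiable (by norm_num) xm) hloc
  obtain ⟨hZΩ, hlt2⟩ := hb3 (y := xm) (by rw [dist_eq_norm]; linarith)
  have e : Z xm + (xm - Z xm) = xm := by abel
  have hθ' : ContDiff ℝ 2 (fun y => θ (y + (xm - Z xm))) :=
    hθC.comp (contDiff_id.add contDiff_const)
  have h4 : gradient (fun y => θ (y + (xm - Z xm))) (Z xm) = -((2 * a) • (Z xm - xm)) := by
    rw [← h2]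
    unfold gradient
    rw [fderiv_comp_add_right, e, fderiv_fun_neg, map_neg, neg_neg]
  have h3 := hsup (Z xm) hZΩ _ hθ'.contDiffAt (by
    filter_upwards [h1.on_subset hΩK] with y hy
    linarith) (c - κ) (by
    intro ξ hξ
    have hqD : ∀ i, D2 q xm (ξ i) = - (2 * τ) := by
      intro i
      rw [hq, D2_quad, hξ.1 i]; ring
    have := hΘD xm ξ hξ
    simp only [D2_comp_add, e]
    simp only [hθ, D2_add hΘ.contDiffAt hqC.contDiffAt, Finset.sum_add_distrib, hqD]
    rw [Finset.sum_const, Finset.card_univ, Fintype.card_fin, nsmul_eq_mul]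
    linarith)
  rw [h4] at h3
  linarith
end Core

section Doubling
variable {E : Type*} [NormedAddCommGroup E] [InnerProductSpace ℝ E]

theorem doubling_max {K : Set E} (hK : IsCompact K) (hne : K.Nonempty)
    {v u : E → ℝ} (hv : UpperSemicontinuousOn v K) (hu : LowerSemicontinuousOn u K)
    {a : ℝ} (ha : 0 < a) : ∃ yh ∈ K, ∃ zh ∈ K, ∀ y ∈ K, ∀ z ∈ K,
      v y - u z - a / 2 * ‖y - z‖ ^ 2 ≤ v yh - u zh - a / 2 * ‖yh - zh‖ ^ 2 := by
  have hu' : UpperSemicontinuousOn (fun x => - u x) K := fun x hx b hb => by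
    have := hu x hx (-b) (by simp only at hb; linarith)
    filter_upwards [this] with y hy
    linarith
  obtain ⟨W, Z, hW⟩ := exists_SC hK hne hu' (a / 2)
  have hWc := hW.continuous hK (by positivity)
  have hs : UpperSemicontinuousOn (fun z => v z + W z) K :=
    hv.add (hWc.upperSemicontinuous.upperSemicontinuousOn _)
  obtain ⟨yh, hy, hm⟩ := hs.exists_isMaxOn hne hK
  refine ⟨yh, hy, Z yh, hW.mem yh, fun y hy z hz => ?_⟩
  have h1 := hm hy
  simp only [mem_ofPred_eq] at h1
  have h2 := hW.le y z hz
  have h3 := hW.eq yh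
  linarith

theorem doubling {K Ω : Set E} (hK : IsCompact K)
    {v u : E → ℝ} (hv : UpperSemicontinuousOn v K) (hu : LowerSemicontinuousOn u K)
    (hΩ : IsOpen Ω)
    (hle : ∀ x ∈ K, v x ≤ u x) (hlt : ∀ x ∈ K, x ∉ Ω → v x < u x) (hneg : ∀ x ∈ K, v x < 0)
    {xh : E} (hxh : xh ∈ K) (heq : v xh = u xh) :
    ∃ l < 0, ∀ σ > 0, ∃ a > 0, ∃ yh ∈ Ω, ∃ zh ∈ Ω, (∀ y ∈ K, ∀ z ∈ K,
      v y - u z - a / 2 * ‖y - z‖ ^ 2 ≤ v yh - u zh - a / 2 * ‖yh - zh‖ ^ 2) ∧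
      |v yh - l| < σ ∧ |u zh - l| < σ ∧ ‖yh - zh‖ + a * ‖yh - zh‖ ^ 2 < σ := by
  have hne : K.Nonempty := ⟨xh, hxh⟩
  have hmx := fun n : ℕ => doubling_max hK hne hv hu (a := (n : ℝ) + 1) (by positivity)
  choose Y hY Z hZ hm using hmx
  have hm0 : ∀ n : ℕ, ((n : ℝ) + 1) / 2 * ‖Y n - Z n‖ ^ 2 ≤ v (Y n) - u (Z n) := by
    intro n
    have := hm n xh hxh xh hxh
    simp only [sub_self, norm_zero, heq] at this
    norm_num at this
    linarith
  obtain ⟨m, hmK, hmin⟩ := hu.exists_isMinOn hne hK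
  obtain ⟨yb, hyb, s, hs, hys⟩ := hK.tendsto_subseq hY
  have hd : Tendsto (fun n => ‖Y n - Z n‖) atTop (𝓝 0) := by
    have h1 : ∀ n : ℕ, ‖Y n - Z n‖ ^ 2 ≤ (2 * |u m|) * (1 / ((n : ℝ) + 1)) := by
      intro n
      have h2 := hm0 n
      have h3 := hneg _ (hY n)
      have h4 := hmin (hZ n)
      simp only [mem_ofPred_eq] at h4
      have h5 := neg_abs_le (u m)
      rw [mul_one_div, le_div_iff₀ (by positivity)]
      linarith
    have h2 : Tendsto (fun n : ℕ => (2 * |u m|) * (1 / ((n : ℝ) + 1))) atTop (𝓝 0) := by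
      simpa using tendsto_one_div_add_atTop_nhds_zero_nat.const_mul (2 * |u m|)
    have h3 := squeeze_zero (fun n => sq_nonneg _) h1 h2
    have h4 := (Real.continuous_sqrt.tendsto 0).comp h3
    simpa [Function.comp_def, Real.sqrt_sq] using h4
  have hds := hd.comp hs.tendsto_atTop
  have hzs : Tendsto (Z ∘ s) atTop (𝓝 yb) := by
    have h1 : Tendsto (fun n => Y (s n) - Z (s n)) atTop (𝓝 0) :=
      tendsto_zero_iff_norm_tendsto_zero.2 hds
    have h2 := hys.sub h1
    simpa [Function.comp_def] using h2
  have evv : ∀ ε > 0, ∀ᶠ n in atTop, v (Y (s n)) < v yb + ε := by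
    intro ε hε
    have := hv yb hyb (v yb + ε) (by linarith)
    exact (tendsto_nhdsWithin_iff.2 ⟨hys, Eventually.of_forall fun n => hY _⟩).eventually this
  have evu : ∀ ε > 0, ∀ᶠ n in atTop, u yb - ε < u (Z (s n)) := by
    intro ε hε
    have := hu yb hyb (u yb - ε) (by linarith)
    exact (tendsto_nhdsWithin_iff.2 ⟨hzs, Eventually.of_forall fun n => hZ _⟩).eventually this
  have hyeq : u yb = v yb := by
    refine le_antisymm ?_ (hle _ hyb)
    refine le_of_forall_pos_le_add fun ε hε => ?_
    obtain ⟨n, h1, h2⟩ := ((evv (ε / 2) (by positivity)).and (evu (ε / 2) (by positivity))).exists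
    have h3 := hm0 (s n)
    have h4 : 0 ≤ ((s n : ℝ) + 1) / 2 * ‖Y (s n) - Z (s n)‖ ^ 2 := by positivity
    linarith
  have hyΩ : yb ∈ Ω := by
    by_contra h
    exact absurd (hlt yb hyb h) (by linarith)
  refine ⟨v yb, hneg _ hyb, fun σ hσ => ?_⟩
  obtain ⟨n, ⟨⟨h1, h2⟩, h3⟩, h4, h5⟩ := (((evv (σ / 8) (by positivity)).and
    (evu (σ / 8) (by positivity))).and (hds.eventually (gt_mem_nhds (half_pos hσ)))).and
      ((hys.eventually (hΩ.mem_nhds hyΩ)).and (hzs.eventually (hΩ.mem_nhds hyΩ))) |>.exists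
  have h6 := hm0 (s n)
  have h7 : 0 ≤ ((s n : ℝ) + 1) / 2 * ‖Y (s n) - Z (s n)‖ ^ 2 := by positivity
  simp only [Function.comp_apply] at h3
  refine ⟨(s n : ℝ) + 1, by positivity, Y (s n), h4, Z (s n), h5, hm (s n), ?_, ?_, ?_⟩
  · rw [abs_lt]; constructor <;> linarith
  · rw [abs_lt]; constructor <;> linarith
  · linarith
end Doubling

section Final
variable {N : ℕ}

theorem Pminus_le {k : ℕ} (φ : EuclideanSpace ℝ (Fin N) → ℝ) (x : EuclideanSpace ℝ (Fin N))
    (ξ : Fin k → EuclideanSpace ℝ (Fin N)) (hξ : Orthonormal ℝ ξ) :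
    Pminus k φ x ≤ ∑ i, D2 φ x (ξ i) := by
  refine csInf_le ?_ ⟨ξ, hξ, by simp only [D2_eq]⟩
  refine ⟨-(k * ‖fderiv ℝ (fderiv ℝ φ) x‖), ?_⟩
  rintro s ⟨ζ, hζ, rfl⟩
  have h : ∀ i, -‖fderiv ℝ (fderiv ℝ φ) x‖ ≤ iteratedFDeriv ℝ 2 φ x ![ζ i, ζ i] := by
    intro i
    rw [D2_eq]
    have h1 := (fderiv ℝ (fderiv ℝ φ) x).le_opNorm₂ (ζ i) (ζ i)
    rw [hζ.1 i, mul_one, mul_one, Real.norm_eq_abs] at h1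
    exact (abs_le.1 h1).1
  have h2 := Finset.sum_le_sum fun i (_ : i ∈ (Finset.univ : Finset (Fin k))) => h i
  simpa using h2

theorem le_Pminus {k : ℕ} (hk : k ≤ N) (φ : EuclideanSpace ℝ (Fin N) → ℝ)
    (x : EuclideanSpace ℝ (Fin N)) (c : ℝ)
    (h : ∀ ξ : Fin k → EuclideanSpace ℝ (Fin N), Orthonormal ℝ ξ → c ≤ ∑ i, D2 φ x (ξ i)) :
    c ≤ Pminus k φ x := by
  refine le_csInf ?_ ?_
  · exact ⟨_, fun i => EuclideanSpace.basisFun (Fin N) ℝ (Fin.castLE hk i),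
      (EuclideanSpace.basisFun (Fin N) ℝ).orthonormal.comp _ (Fin.castLE_injective hk), rfl⟩
  · rintro s ⟨ζ, hζ, rfl⟩
    simpa only [D2_eq] using h ζ hζ

theorem gradient_const_mul' {φ : EuclideanSpace ℝ (Fin N) → ℝ} {x : EuclideanSpace ℝ (Fin N)}
    (h : DifferentiableAt ℝ φ x) (c : ℝ) :
    gradient (fun y => c * φ y) x = c • gradient φ x := by
  unfold gradient
  rw [fderiv_const_mul h, map_smulₛₗ]
  simp

theorem main_aux (k : ℕ) (hk1 : 1 ≤ k) (hkN : k < N)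
    (Ω : Set (EuclideanSpace ℝ (Fin N))) (hΩopen : IsOpen Ω)
    (hΩbdd : Bornology.IsBounded Ω)
    (H : EuclideanSpace ℝ (Fin N) → EuclideanSpace ℝ (Fin N) → ℝ)
    (hHcont : ContinuousOn (Function.uncurry H)
      (Ω ×ˢ (univ : Set (EuclideanSpace ℝ (Fin N)))))
    (hSC2 : SC2 Ω H) (hSC3 : SC3 Ω H)
    (μ : ℝ) (hμ : (μ : EReal) < muBarMinus k Ω H)
    (u : EuclideanSpace ℝ (Fin N) → ℝ)
    (hu : LowerSemicontinuousOn u Ω)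
    (hsuper : IsViscSupersol (Pminus k) Ω H μ (fun _ => 0) u)
    (hbdry : ∀ z ∈ frontier Ω, ∀ ε > 0, ∀ᶠ x in 𝓝[Ω] z, -ε < u x) :
    ∀ x ∈ Ω, 0 ≤ u x := by
  classical
  intro x1 hx1
  by_contra! hneg
  obtain ⟨m, ⟨ρ, rfl, w, hw, hw0, hwsub⟩, hρ⟩ := lt_sSup_iff.1 hμ
  have hρ : μ < ρ := by exact_mod_cast hρ
  set K := closure Ω with hKd
  have hK : IsCompact K := hΩbdd.isCompact_closure
  have hΩK : Ω ⊆ K := subset_closure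
  set U : EuclideanSpace ℝ (Fin N) → ℝ := fun x => if x ∈ Ω then u x else 0 with hU
  have hUin : ∀ x ∈ Ω, U x = u x := fun x hx => if_pos hx
  have hUout : ∀ x, x ∉ Ω → U x = 0 := fun x hx => if_neg hx
  have hUlsc : LowerSemicontinuousOn U K := by
    intro x hx b hb
    refine mem_nhdsWithin_of_mem_nhds ?_
    by_cases hxΩ : x ∈ Ω
    · rw [hUin x hxΩ] at hb
      have h1 := hu x hxΩ b hb
      rw [hΩopen.nhdsWithin_eq hxΩ] at h1
      filter_upwards [h1, hΩopen.mem_nhds hxΩ] with y hy hyΩ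
      rwa [hUin y hyΩ]
    · rw [hUout x hxΩ] at hb
      have hf : x ∈ frontier Ω := by
        rw [frontier, hΩopen.interior_eq]; exact ⟨hx, hxΩ⟩
      have h1 := hbdry x hf (-b) (by linarith)
      rw [eventually_nhdsWithin_iff] at h1
      filter_upwards [h1] with y hy
      by_cases hyΩ : y ∈ Ω
      · rw [hUin y hyΩ]; linarith [hy hyΩ]
      · rwa [hUout y hyΩ]
  set g : EuclideanSpace ℝ (Fin N) → ℝ := fun x => min (U x / (- w x)) 0 with hg
  have hgl : LowerSemicontinuousOn g K := by
    intro x hx b hb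
    have hb0 : b < 0 := hb.trans_le (min_le_right _ _)
    have hb1 : b < U x / (- w x) := hb.trans_le (min_le_left _ _)
    rw [lt_div_iff₀ (by linarith [hw0 x hx])] at hb1
    obtain ⟨e, he, hee⟩ : ∃ e > 0, 2 * e = U x + b * w x :=
      ⟨(U x + b * w x) / 2, by linarith, by ring⟩
    have h1 := hUlsc x hx (U x - e) (by linarith)
    have h2 := hw x hx (w x + e / (-b)) (by
      have : 0 < e / (-b) := div_pos he (by linarith)
      linarith)
    filter_upwards [h1, h2, self_mem_nhdsWithin] with y h3 h4 hyK
    refine lt_min ?_ hb0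
    rw [lt_div_iff₀ (by linarith [hw0 y hyK])]
    have h5 : (-b) * w y < (-b) * (w x + e / (-b)) :=
      mul_lt_mul_of_pos_left h4 (by linarith)
    have h6 : (-b) * (w x + e / (-b)) = -b * w x + e := by
      rw [mul_add, mul_div_cancel₀ _ (by linarith : -b ≠ 0)]
    linarith
  obtain ⟨xh, hxh, hmin⟩ := hgl.exists_isMinOn ⟨x1, hΩK hx1⟩ hK
  have hgx1 : g x1 < 0 := by
    refine (min_le_left _ _).trans_lt ?_
    rw [hUin x1 hx1]
    exact div_neg_of_neg_of_pos hneg (by linarith [hw0 x1 (hΩK hx1)])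
  set γ := - g xh with hγd
  have hmin' : ∀ x ∈ K, -γ ≤ g x := fun x hx => by
    have := hmin hx
    simp only [mem_ofPred_eq] at this
    linarith
  have hγ : 0 < γ := by linarith [hmin' x1 (hΩK hx1)]
  set v : EuclideanSpace ℝ (Fin N) → ℝ := fun x => γ * w x with hv
  have hle : ∀ x ∈ K, v x ≤ U x := by
    intro x hx
    have h1 := (hmin' x hx).trans (min_le_left _ _)
    rw [le_div_iff₀ (by linarith [hw0 x hx])] at h1
    simp only [hv]
    linarith
  have hvneg : ∀ x ∈ K, v x < 0 := fun x hx => mul_neg_of_pos_of_neg hγ (hw0 x hx)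
  have hlt : ∀ x ∈ K, x ∉ Ω → v x < U x := fun x hx hxΩ => by
    rw [hUout x hxΩ]; exact hvneg x hx
  have heq : v xh = U xh := by
    have h1 : U xh / (- w xh) = -γ := by
      have h2 : g xh = -γ := by rw [hγd, neg_neg]
      simp only [hg] at h2
      rcases min_choice (U xh / (- w xh)) 0 with h | h
      · rw [← h]; exact h2
      · linarith
    rw [div_eq_iff (by linarith [hw0 xh hxh])] at h1
    simp only [hv]
    linarith
  have hvusc : UpperSemicontinuousOn v K := by
    intro x hx b hb
    have h1 := hw x hx (b / γ) (by
      change w x < b / γ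
      rw [lt_div_iff₀ hγ]; simp only [hv] at hb; linarith)
    filter_upwards [h1] with y hy
    rw [lt_div_iff₀ hγ] at hy
    simp only [hv]
    linarith
  have hsub : ∀ y ∈ Ω, ∀ φ : EuclideanSpace ℝ (Fin N) → ℝ, ContDiffAt ℝ 2 φ y →
      IsLocalMaxOn (fun x => v x - φ x) Ω y →
      ∀ ξ : Fin k → EuclideanSpace ℝ (Fin N), Orthonormal ℝ ξ →
        0 ≤ ∑ i, D2 φ y (ξ i) + H y (gradient φ y) + ρ * v y := by
    intro y hy φ hφ hm ξ hξ
    have h1 := hwsub y hy (fun x => γ⁻¹ * φ x) (contDiffAt_const.mul hφ) (by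
      filter_upwards [hm] with x hx
      simp only [hv] at hx
      have e : ∀ z, w z - γ⁻¹ * φ z = γ⁻¹ * (γ * w z - φ z) := by
        intro z; field_simp
      rw [e, e]
      exact mul_le_mul_of_nonneg_left hx (by positivity))
    rw [gradient_const_mul' (cda_diff1 hφ), hSC2 y hy _ (by positivity)] at h1
    have h2 := Pminus_le (fun x => γ⁻¹ * φ x) y ξ hξ
    simp only [D2_const_mul hφ, ← Finset.mul_sum] at h2
    have h3 : 0 ≤ γ * (γ⁻¹ * ∑ i, D2 φ y (ξ i) + γ⁻¹ * H y (gradient φ y) + ρ * w y) := by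
      apply mul_nonneg hγ.le
      linarith
    have h4 : γ * (γ⁻¹ * ∑ i, D2 φ y (ξ i) + γ⁻¹ * H y (gradient φ y) + ρ * w y) =
        ∑ i, D2 φ y (ξ i) + H y (gradient φ y) + ρ * v y := by
      simp only [hv]
      field_simp
    linarith
  have hsup : ∀ z ∈ Ω, ∀ φ : EuclideanSpace ℝ (Fin N) → ℝ, ContDiffAt ℝ 2 φ z →
      IsLocalMinOn (fun x => U x - φ x) Ω z →
      ∀ c, (∀ ξ : Fin k → EuclideanSpace ℝ (Fin N), Orthonormal ℝ ξ → c ≤ ∑ i, D2 φ z (ξ i)) →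
        c + H z (gradient φ z) + μ * U z ≤ 0 := by
    intro z hz φ hφ hm c hc
    have h1 := hsuper z hz φ hφ (by
      filter_upwards [hm, self_mem_nhdsWithin] with x hx hxΩ
      rwa [hUin x hxΩ, hUin z hz] at hx)
    have h2 := le_Pminus hkN.le φ z c hc
    rw [hUin z hz]
    linarith
  obtain ⟨l, hl, hdoub⟩ := doubling hK hvusc hUlsc hΩopen hle hlt hvneg hxh heq
  obtain ⟨ω, hωm, hωt, hω⟩ := hSC3
  obtain ⟨s, hs, hss⟩ : ∃ s > 0, (2 : ℝ) * s = (μ - ρ) * l :=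
    ⟨(μ - ρ) * l / 2, by nlinarith, by ring⟩
  obtain ⟨t0, hωt0, ht0⟩ := ((hωt.eventually (gt_mem_nhds hs)).and self_mem_nhdsWithin).exists
  have ht0 : 0 < t0 := ht0
  set S := |μ| + |ρ| + 1 with hS
  have hS0 : 0 < S := by positivity
  obtain ⟨a, ha, yh, hy, zh, hz, hmax, h1, h2, h3⟩ := hdoub (min t0 (s / S)) (by positivity)
  have hc := core hk1 hK hΩopen hΩK hvusc hUlsc hHcont hsub hsup ha hy hz hmax
  have h4 := hω yh hy zh hz (a • (yh - zh))
  have h5 : ‖yh - zh‖ * (1 + ‖a • (yh - zh)‖) ≤ t0 := by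
    rw [norm_smul, Real.norm_of_nonneg ha.le]
    have := min_le_left t0 (s / S)
    nlinarith
  have h6 := hωm h5
  have h7 := le_abs_self (H yh (a • (yh - zh)) - H zh (a • (yh - zh)))
  have h8 : μ * U zh - ρ * v yh < s := by linarith
  have h9 : |μ * (U zh - l)| ≤ |μ| * (s / S) := by
    rw [abs_mul]
    exact mul_le_mul_of_nonneg_left (h2.le.trans (min_le_right _ _)) (abs_nonneg _)
  have h10 : |ρ * (v yh - l)| ≤ |ρ| * (s / S) := by
    rw [abs_mul]
    exact mul_le_mul_of_nonneg_left (h1.le.trans (min_le_right _ _)) (abs_nonneg _)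
  have h11 : S * (s / S) = s := by field_simp
  have h12 : 0 < s / S := by positivity
  have h13 := (abs_le.1 h9).1
  have h14 := (abs_le.1 h10).2
  have h15 : |μ| * (s / S) + |ρ| * (s / S) + s / S = s := by
    calc _ = S * (s / S) := by rw [hS]; ring
      _ = s := h11
  linarith
end Final

/-- the weak minimum principle holds for
`𝒫⁻ₖ(D²·) + H(x,∇·) + μ·` in a bounded open set whenever `μ < μ̄ₖ⁻(Ω)`. -/
theorem statement8 {N : ℕ} (hN : 2 ≤ N) (k : ℕ) (hk1 : 1 ≤ k) (hkN : k < N)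
    (Ω : Set (EuclideanSpace ℝ (Fin N))) (hΩopen : IsOpen Ω)
    (hΩbdd : Bornology.IsBounded Ω)
    (H : EuclideanSpace ℝ (Fin N) → EuclideanSpace ℝ (Fin N) → ℝ)
    (hHcont : ContinuousOn (Function.uncurry H)
      (Ω ×ˢ (univ : Set (EuclideanSpace ℝ (Fin N)))))
    (hSC2 : SC2 Ω H) (hSC3 : SC3 Ω H)
    (μ : ℝ) (hμ : (μ : EReal) < muBarMinus k Ω H)
    (u : EuclideanSpace ℝ (Fin N) → ℝ)
    (hu : LowerSemicontinuousOn u Ω)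
    (hsuper : IsViscSupersol (Pminus k) Ω H μ (fun _ => 0) u)
    (hbdry : ∀ z ∈ frontier Ω, ∀ ε > 0, ∀ᶠ x in 𝓝[Ω] z, -ε < u x) :
    ∀ x ∈ Ω, 0 ≤ u x := by
  exact main_aux k hk1 hkN Ω hΩopen hΩbdd H hHcont hSC2 hSC3 μ hμ u hu hsuper hbdry
end
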